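/- arXiv:2304.04799 — 4 statements merged into one kernel-verified Lean document; each statement's English description precedes it below -/
import Mathlib

section
/- Let d ≤ m, let G be an invertible d×d real matrix, and let Ξ be a real d×m matrix whose first d columns are linearly independent and each of whose columns lies in the lattice GZ^d := {Gv : v ∈ ℤ^d}. Then the shifts of the centered box spline over the lattice form a (scaled) partition of unity: for every x ∈ ℝ^d, the family (M_Ξ(x − j))_{j ∈ GZ^d} has only finitely many nonzero terms and ∑_{j ∈ GZ^d} M_Ξ(x − j) = 1/|det G|. -/
open MeasureTheory

/-- The centered box spline for a `d × (d+n)` direction matrix, by recursion on `n`: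
for `n = 0` it is the normalized indicator of the half-open parallelepiped
`Ξ [-1/2,1/2)^d`; for `n+1` it is the average of the translates of the box spline of
`Ξ` with its last column removed, in the direction of that last column. -/
noncomputable def boxSplineAux (d : ℕ) : (n : ℕ) → Matrix (Fin d) (Fin (d + n)) ℝ → ((Fin d → ℝ) → ℝ)
  | 0, Ξ => fun x =>
      Set.indicator
        {y : Fin d → ℝ | ∃ t : Fin d → ℝ, (∀ i, t i ∈ Set.Ico (-(1:ℝ)/2) (1/2)) ∧
          y = Matrix.mulVec (Matrix.of fun (i j : Fin d) => Ξ i (Fin.cast (Nat.add_zero d).symm j)) t}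
        (fun _ => |Matrix.det (Matrix.of fun (i j : Fin d) => Ξ i (Fin.cast (Nat.add_zero d).symm j))|⁻¹) x
  | (n+1), Ξ => fun x =>
      ∫ t in (-(1:ℝ)/2)..(1/2),
        boxSplineAux d n (fun i j => Ξ i (Fin.castSucc j)) (x - t • fun i => Ξ i (Fin.last (d + n)))

/-- The centered box spline `M_Ξ` of a `d × m` direction matrix `Ξ`, `d ≤ m`. -/
noncomputable def boxSpline {d m : ℕ} (hdm : d ≤ m) (Ξ : Matrix (Fin d) (Fin m) ℝ) :
    (Fin d → ℝ) → ℝ :=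
  boxSplineAux d (m - d) (fun i j => Ξ i (Fin.cast (Nat.add_sub_cancel' hdm) j))

/-- The half-open parallelepiped spanned by the columns of an invertible integer matrix `A`,
placed anywhere, meets the integer lattice in exactly `|det A|` points. -/
theorem ncard_int_points_parallelepiped {d : ℕ} (A : Matrix (Fin d) (Fin d) ℤ) (hA : A.det ≠ 0)
    (y : Fin d → ℝ) :
    {v : Fin d → ℤ | ∃ t : Fin d → ℝ, (∀ i, t i ∈ Set.Ico (-(1:ℝ)/2) (1/2)) ∧
      (y - fun i => (v i : ℝ)) = (A.map (Int.cast : ℤ → ℝ)).mulVec t}.ncard = A.det.natAbs := by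
  set S := {v : Fin d → ℤ | ∃ t : Fin d → ℝ, (∀ i, t i ∈ Set.Ico (-(1:ℝ)/2) (1/2)) ∧
      (y - fun i => (v i : ℝ)) = (A.map (Int.cast : ℤ → ℝ)).mulVec t} with hS
  set L := A.map (Int.cast : ℤ → ℝ) with hL
  have hLdet : IsUnit L.det := by
    rw [isUnit_iff_ne_zero, hL, ← Int.cast_det]
    exact_mod_cast hA
  have hLinj : Function.Injective L.mulVec :=
    Matrix.mulVec_injective_of_isUnit ((Matrix.isUnit_iff_isUnit_det L).2 hLdet)
  have hLcast (w : Fin d → ℤ) :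
      L.mulVec (fun i => (w i : ℝ)) = fun i => ((A.mulVec w i : ℤ) : ℝ) := by
    ext i
    simp [hL, Matrix.mulVec, dotProduct]
  have hAinj : Function.Injective A.mulVecLin := Matrix.mulVec_injective_of_det_ne_zero hA
  have hcard : A.det.natAbs = Nat.card ((Fin d → ℤ) ⧸ LinearMap.range A.mulVecLin) := by
    rw [← Submodule.natAbs_det_equiv _ (LinearEquiv.ofInjective A.mulVecLin hAinj)]
    congr 1
    rw [← LinearMap.det_toLin' A]
    rfl
  rw [hcard, ← Nat.card_coe_set_eq]
  refine Nat.card_eq_of_bijective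
    (fun v : S => (Submodule.Quotient.mk v.1 : (Fin d → ℤ) ⧸ LinearMap.range A.mulVecLin)) ⟨?_, ?_⟩
  · rintro ⟨v, t, ht, hvt⟩ ⟨v', t', ht', hvt'⟩ h
    rw [Submodule.Quotient.eq] at h
    obtain ⟨w, hw⟩ := h
    have hw' : A.mulVec w = v - v' := hw
    have key : L.mulVec (fun i => (w i : ℝ)) = L.mulVec (t' - t) := by
      rw [Matrix.mulVec_sub, ← hvt, ← hvt', hLcast, hw']
      ext i
      simp
    have hw0 : w = 0 := by
      ext i
      have h1 : (w i : ℝ) = t' i - t i := congrFun (hLinj key) i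
      have h2 := ht i
      have h3 := ht' i
      simp only [Set.mem_Ico] at h2 h3
      have h4 : (w i : ℝ) < 1 := by linarith
      have h5 : (-1 : ℝ) < w i := by linarith
      have h6 : w i < 1 := by exact_mod_cast h4
      have h7 : -1 < w i := by exact_mod_cast h5
      simp only [Pi.zero_apply]
      omega
    rw [hw0, Matrix.mulVec_zero] at hw'
    exact Subtype.ext (sub_eq_zero.1 hw'.symm)
  · intro q
    obtain ⟨u, rfl⟩ := Submodule.Quotient.mk_surjective _ q
    set z := L⁻¹.mulVec (y - fun i => (u i : ℝ)) with hz
    set w : Fin d → ℤ := fun i => ⌊z i + 1 / 2⌋ with hw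
    refine ⟨⟨u + A.mulVec w, z - fun i => (w i : ℝ), fun i => ?_, ?_⟩, ?_⟩
    · have h1 := Int.floor_le (z i + 1 / 2)
      have h2 := Int.lt_floor_add_one (z i + 1 / 2)
      simp only [hw, Pi.sub_apply, Set.mem_Ico]
      constructor <;> linarith
    · rw [Matrix.mulVec_sub, hLcast, hz, Matrix.mulVec_mulVec, Matrix.mul_nonsing_inv _ hLdet,
        Matrix.one_mulVec]
      ext i
      simp only [Pi.sub_apply, Pi.add_apply]
      push_cast
      ring
    · rw [Submodule.Quotient.eq]
      exact ⟨w, by simp⟩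

/-- Only finitely many points of the lattice `G ℤ^d` lie within a given distance of `x`. -/
theorem finite_lattice_points_near {d : ℕ} (G : Matrix (Fin d) (Fin d) ℝ) (hG : IsUnit G.det)
    (x : Fin d → ℝ) (R : ℝ) :
    {v : Fin d → ℤ | ‖x - G.mulVec fun i => (v i : ℝ)‖ ≤ R}.Finite := by
  set T := LinearMap.toContinuousLinearMap G⁻¹.mulVecLin
  refine ((isCompact_closedBall (0 : Fin d → ℤ) (‖T‖ * (‖x‖ + R))).finite_of_discrete).subset ?_
  intro v hv
  have hTv : T (G.mulVec fun i => (v i : ℝ)) = fun i => (v i : ℝ) := by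
    change G⁻¹.mulVec _ = _
    rw [Matrix.mulVec_mulVec, Matrix.nonsing_inv_mul _ hG, Matrix.one_mulVec]
  have hnorm : ‖v‖ = ‖fun i => (v i : ℝ)‖ := by
    simp only [Pi.norm_def]
    congr 2
  have hGv : ‖G.mulVec fun i => (v i : ℝ)‖ ≤ ‖x‖ + R := by
    have := norm_sub_norm_le (G.mulVec fun i => (v i : ℝ)) x
    rw [norm_sub_rev] at this
    have hv' : ‖x - G.mulVec fun i => (v i : ℝ)‖ ≤ R := hv
    linarith
  rw [mem_closedBall_zero_iff, hnorm, ← hTv]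
  exact (T.le_opNorm _).trans (by gcongr)

/-- Bounded measurable functions of bounded support whose translates along the lattice `G ℤ^d`
sum to `1 / |det G|`. -/
structure IsLatticePartition {d : ℕ} (G : Matrix (Fin d) (Fin d) ℝ) (f : (Fin d → ℝ) → ℝ) :
    Prop where
  measurable : Measurable f
  bounded : ∃ C, ∀ x, ‖f x‖ ≤ C
  bounded_support : ∃ R, ∀ x, f x ≠ 0 → ‖x‖ ≤ R
  finsum_eq : ∀ x, ∑ᶠ v : Fin d → ℤ, f (x - G.mulVec fun i => (v i : ℝ)) = |G.det|⁻¹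

/-- Averaging along a segment preserves being a lattice partition. -/
theorem IsLatticePartition.average {d : ℕ} {G : Matrix (Fin d) (Fin d) ℝ} (hG : IsUnit G.det)
    {f : (Fin d → ℝ) → ℝ} (hf : IsLatticePartition G f) (ξ : Fin d → ℝ) :
    IsLatticePartition G fun x => ∫ t in (-(1:ℝ)/2)..(1/2), f (x - t • ξ) := by
  obtain ⟨C, hC⟩ := hf.bounded
  obtain ⟨R, hR⟩ := hf.bounded_support
  have hle : (-(1:ℝ)/2) ≤ 1/2 := by norm_num
  have hnear (x : Fin d → ℝ) (t : ℝ) (ht : t ∈ Set.uIcc (-(1:ℝ)/2) (1/2))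
      (hx : f (x - t • ξ) ≠ 0) : ‖x‖ ≤ R + ‖ξ‖ := by
    rw [Set.uIcc_of_le hle, Set.mem_Icc] at ht
    have h1 := hR _ hx
    have h2 : ‖x‖ ≤ ‖x - t • ξ‖ + ‖t • ξ‖ := by simpa using norm_add_le (x - t • ξ) (t • ξ)
    have h3 : ‖t • ξ‖ ≤ 1 * ‖ξ‖ := by
      rw [norm_smul]
      gcongr
      rw [Real.norm_eq_abs, abs_le]
      constructor <;> linarith
    linarith
  have hsupp (x : Fin d → ℝ) (hx : ∫ t in (-(1:ℝ)/2)..(1/2), f (x - t • ξ) ≠ 0) :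
      ‖x‖ ≤ R + ‖ξ‖ := by
    by_contra hcon
    refine hx ?_
    rw [intervalIntegral.integral_congr (g := fun _ => (0 : ℝ)), intervalIntegral.integral_zero]
    intro t ht
    by_contra h
    exact hcon (hnear x t ht h)
  refine ⟨?_, ⟨C, fun x => ?_⟩, ⟨R + ‖ξ‖, hsupp⟩, fun x => ?_⟩
  · simp only [intervalIntegral.integral_of_le hle]
    refine (StronglyMeasurable.integral_prod_right
      (f := fun (x : Fin d → ℝ) (t : ℝ) => f (x - t • ξ)) ?_).measurable
    exact (hf.measurable.comp (by fun_prop)).stronglyMeasurable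
  · have := intervalIntegral.norm_integral_le_of_norm_le_const (a := -(1:ℝ)/2) (b := 1/2)
      (f := fun t => f (x - t • ξ)) (C := C) fun t _ => hC _
    rwa [show (1:ℝ) / 2 - -(1:ℝ) / 2 = 1 by norm_num, abs_one, mul_one] at this
  · set F := (finite_lattice_points_near G hG x (R + ‖ξ‖)).toFinset with hF
    have hmem (v : Fin d → ℤ) : v ∈ F ↔ ‖x - G.mulVec fun i => (v i : ℝ)‖ ≤ R + ‖ξ‖ := by
      simp [hF]
    rw [finsum_eq_sum_of_support_subset (s := F) _ fun v hv => (hmem v).2 (hsupp _ hv),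
      ← intervalIntegral.integral_finsetSum]
    · rw [intervalIntegral.integral_congr (g := fun _ => |G.det|⁻¹)]
      · rw [intervalIntegral.integral_const]
        norm_num
      intro t ht
      simp only
      rw [← hf.finsum_eq (x - t • ξ), finsum_eq_sum_of_support_subset (s := F)]
      · exact Finset.sum_congr rfl fun v _ => by rw [sub_right_comm]
      · intro v hv
        refine (hmem v).2 (hnear _ t ht ?_)
        rw [sub_right_comm]
        exact hv
    · intro v _
      rw [intervalIntegrable_iff_integrableOn_Ioc_of_le hle]
      refine Measure.integrableOn_of_bounded (M := C) (by simp) ?_ (.of_forall fun t => hC _)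
      exact (hf.measurable.comp (by fun_prop)).aestronglyMeasurable

/-- The normalized indicator of a half-open parallelepiped spanned by lattice vectors is a
lattice partition. -/
theorem isLatticePartition_indicator_parallelepiped {d : ℕ} {G : Matrix (Fin d) (Fin d) ℝ}
    (hG : IsUnit G.det) (A : Matrix (Fin d) (Fin d) ℤ) (hA : A.det ≠ 0)
    {L : Matrix (Fin d) (Fin d) ℝ} (hL : L = G * A.map (Int.cast : ℤ → ℝ)) :
    IsLatticePartition G (Set.indicator
      {y : Fin d → ℝ | ∃ t : Fin d → ℝ, (∀ i, t i ∈ Set.Ico (-(1:ℝ)/2) (1/2)) ∧ y = L.mulVec t}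
      fun _ => |L.det|⁻¹) := by
  have hdet : L.det = G.det * (A.det : ℝ) := by
    rw [hL, Matrix.det_mul, Int.cast_det]
  have hA' : (A.det : ℝ) ≠ 0 := by exact_mod_cast hA
  have hLdet : IsUnit L.det := by
    rw [hdet]
    exact hG.mul (isUnit_iff_ne_zero.2 hA')
  refine ⟨?_, ⟨|L.det|⁻¹, fun x => ?_⟩,
    ⟨‖LinearMap.toContinuousLinearMap L.mulVecLin‖ * (1 / 2), ?_⟩, fun x => ?_⟩
  · refine measurable_const.indicator ?_
    have hset : {y : Fin d → ℝ | ∃ t : Fin d → ℝ, (∀ i, t i ∈ Set.Ico (-(1:ℝ)/2) (1/2)) ∧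
        y = L.mulVec t} = L⁻¹.mulVec ⁻¹' Set.univ.pi fun _ => Set.Ico (-(1:ℝ)/2) (1/2) := by
      ext y
      simp only [Set.mem_ofPred_eq, Set.mem_preimage, Set.mem_univ_pi]
      constructor
      · rintro ⟨t, ht, rfl⟩
        rwa [Matrix.mulVec_mulVec, Matrix.nonsing_inv_mul _ hLdet, Matrix.one_mulVec]
      · intro h
        refine ⟨_, h, ?_⟩
        rw [Matrix.mulVec_mulVec, Matrix.mul_nonsing_inv _ hLdet, Matrix.one_mulVec]
    rw [hset]
    exact (Continuous.matrix_mulVec continuous_const continuous_id).measurable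
      (MeasurableSet.univ_pi fun _ => measurableSet_Ico)
  · refine (norm_indicator_le_norm_self _ _).trans ?_
    simp
  · intro y hy
    obtain ⟨t, ht, rfl⟩ := Set.mem_of_indicator_ne_zero hy
    refine ((LinearMap.toContinuousLinearMap L.mulVecLin).le_opNorm t).trans ?_
    gcongr
    rw [pi_norm_le_iff_of_nonneg (by norm_num)]
    intro i
    have := ht i
    rw [Set.mem_Ico] at this
    rw [Real.norm_eq_abs, abs_le]
    constructor <;> linarith
  · set S := {v : Fin d → ℤ | ∃ t : Fin d → ℝ, (∀ i, t i ∈ Set.Ico (-(1:ℝ)/2) (1/2)) ∧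
      (G⁻¹.mulVec x - fun i => (v i : ℝ)) = (A.map (Int.cast : ℤ → ℝ)).mulVec t} with hS
    have hcard : S.ncard = A.det.natAbs := ncard_int_points_parallelepiped A hA _
    have hfin : S.Finite := Set.finite_of_ncard_ne_zero (by rw [hcard]; simpa using hA)
    have hiff (v : Fin d → ℤ) : (x - G.mulVec fun i => (v i : ℝ)) ∈
        {y : Fin d → ℝ | ∃ t : Fin d → ℝ, (∀ i, t i ∈ Set.Ico (-(1:ℝ)/2) (1/2)) ∧
          y = L.mulVec t} ↔ v ∈ S := by
      simp only [hS, Set.mem_ofPred_eq]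
      refine exists_congr fun t => and_congr_right fun _ => ?_
      rw [hL, ← Matrix.mulVec_mulVec]
      have hGinj : Function.Injective G.mulVec :=
        Matrix.mulVec_injective_of_isUnit ((Matrix.isUnit_iff_isUnit_det G).2 hG)
      rw [← hGinj.eq_iff (a := G⁻¹.mulVec x - _), Matrix.mulVec_sub,
        Matrix.mulVec_mulVec x, Matrix.mul_nonsing_inv _ hG, Matrix.one_mulVec]
    have hsum : ∀ v : Fin d → ℤ, Set.indicator
        {y : Fin d → ℝ | ∃ t : Fin d → ℝ, (∀ i, t i ∈ Set.Ico (-(1:ℝ)/2) (1/2)) ∧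
          y = L.mulVec t} (fun _ => |L.det|⁻¹) (x - G.mulVec fun i => (v i : ℝ)) =
        S.indicator (fun _ => |L.det|⁻¹) v := by
      classical
      intro v
      simp only [Set.indicator_apply, hiff]
    rw [finsum_congr hsum, ← finsum_mem_def, finsum_mem_eq_finite_toFinset_sum _ hfin,
      Finset.sum_const, ← Set.ncard_eq_toFinset_card S hfin, hcard, hdet, nsmul_eq_mul,
      Nat.cast_natAbs, Int.cast_abs, abs_mul, mul_inv]
    field_simp

/-- A box spline whose first `d` directions form an invertible integer matrix in the basis `G`
is a lattice partition for `G`. -/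
theorem isLatticePartition_boxSplineAux {d : ℕ} {G : Matrix (Fin d) (Fin d) ℝ}
    (hG : IsUnit G.det) (A : Matrix (Fin d) (Fin d) ℤ) (hA : A.det ≠ 0) (n : ℕ)
    (Ξ : Matrix (Fin d) (Fin (d + n)) ℝ)
    (hΞ : Ξ.submatrix id (Fin.castAdd n) = G * A.map (Int.cast : ℤ → ℝ)) :
    IsLatticePartition G (boxSplineAux d n Ξ) := by
  induction n with
  | zero => exact isLatticePartition_indicator_parallelepiped hG A hA hΞ
  | succ n ih => exact (ih _ hΞ).average hG _

/-- if all columns of `Ξ` lie in the lattice `G ℤ^d` (`G` invertible), the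
lattice shifts of the centered box spline form a partition of unity scaled by `1/|det G|`. -/
theorem boxSpline_partition_of_unity {d m : ℕ} (hd : 1 ≤ d) (hdm : d ≤ m)
    (G : Matrix (Fin d) (Fin d) ℝ) (hG : IsUnit G.det)
    (Ξ : Matrix (Fin d) (Fin m) ℝ)
    (hΞ : LinearIndependent ℝ fun j : Fin d => fun i => Ξ i (Fin.castLE hdm j))
    (hcols : ∀ j : Fin m, ∃ v : Fin d → ℤ,
      (fun i => Ξ i j) = G.mulVec fun i => (v i : ℝ))
    (x : Fin d → ℝ) :
    (Function.support fun j : Set.range (fun v : Fin d → ℤ => G.mulVec fun i => (v i : ℝ)) =>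
        boxSpline hdm Ξ (x - (j : Fin d → ℝ))).Finite ∧
      ∑ᶠ j : Set.range (fun v : Fin d → ℤ => G.mulVec fun i => (v i : ℝ)),
        boxSpline hdm Ξ (x - (j : Fin d → ℝ)) = |G.det|⁻¹ := by
  choose c hc using hcols
  set A : Matrix (Fin d) (Fin d) ℤ := Matrix.of fun i j => c (Fin.castLE hdm j) i with hAdef
  have hGA : (Matrix.of fun i j => Ξ i (Fin.castLE hdm j)) = G * A.map (Int.cast : ℤ → ℝ) := by
    ext i j
    exact congrFun (hc (Fin.castLE hdm j)) i
  have hA : A.det ≠ 0 := by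
    intro h0
    have hunit : IsUnit (Matrix.of fun i j => Ξ i (Fin.castLE hdm j)) :=
      Matrix.linearIndependent_cols_iff_isUnit.1 hΞ
    rw [Matrix.isUnit_iff_isUnit_det, hGA, Matrix.det_mul, ← Int.cast_det, h0] at hunit
    simp at hunit
  have hP : IsLatticePartition G (boxSpline hdm Ξ) :=
    isLatticePartition_boxSplineAux hG A hA (m - d) _ hGA
  have hinj : Function.Injective fun v : Fin d → ℤ => G.mulVec fun i => (v i : ℝ) := by
    intro v w h
    have h' := Matrix.mulVec_injective_of_isUnit ((Matrix.isUnit_iff_isUnit_det G).2 hG) h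
    ext i
    exact_mod_cast congrFun h' i
  obtain ⟨R, hR⟩ := hP.bounded_support
  constructor
  · refine ((finite_lattice_points_near G hG x R).image
      (Equiv.ofInjective _ hinj)).subset fun j hj => ?_
    obtain ⟨v, rfl⟩ := (Equiv.ofInjective _ hinj).surjective j
    exact ⟨v, hR _ hj, rfl⟩
  · rw [← hP.finsum_eq x]
    exact (finsum_comp_equiv (Equiv.ofInjective _ hinj)).symm
end

section
/- Let d ≤ m and let Ξ be a real d×m matrix whose first d columns are linearly independent. Then the topological support of the centered box spline M_Ξ (the closure of {x ∈ ℝ^d : M_Ξ(x) ≠ 0}) equals the zonotope Ξ[−1/2,1/2]^m = {∑_{i=1}^m t_i ξ_i : t_i ∈ [−1/2,1/2] for all i}. -/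
open MeasureTheory

/-- The first `d` columns of a `d × (d+n)` matrix. -/
def leadingBlock {d n : ℕ} (Ξ : Matrix (Fin d) (Fin (d + n)) ℝ) : Matrix (Fin d) (Fin d) ℝ :=
  Matrix.of fun i j => Ξ i (Fin.castAdd n j)

theorem exists_mulVec_eq_of_isUnit_leadingBlock {d n : ℕ} {Ξ : Matrix (Fin d) (Fin (d + n)) ℝ}
    (hΞ : IsUnit (leadingBlock Ξ).det) (v : Fin d → ℝ) :
    ∃ c : Fin (d + n) → ℝ, Ξ.mulVec c = v := by
  refine ⟨Fin.append ((leadingBlock Ξ)⁻¹.mulVec v) 0, ?_⟩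
  have h : (leadingBlock Ξ).mulVec ((leadingBlock Ξ)⁻¹.mulVec v) = v := by
    rw [Matrix.mulVec_mulVec, Matrix.mul_nonsing_inv _ hΞ, Matrix.one_mulVec]
  nth_rewrite 2 [← h]
  ext i
  simp only [Matrix.mulVec, dotProduct, Fin.sum_univ_add, Fin.append_left, Fin.append_right]
  simp [leadingBlock]

theorem mulVec_eq_castSucc_add_last {d n : ℕ} (Ξ : Matrix (Fin d) (Fin (n + 1)) ℝ)
    (t : Fin (n + 1) → ℝ) :
    Ξ.mulVec t = Matrix.mulVec (fun i j => Ξ i (Fin.castSucc j)) (fun j => t (Fin.castSucc j)) +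
      t (Fin.last n) • fun i => Ξ i (Fin.last n) := by
  ext i
  simp [Matrix.mulVec, dotProduct, Fin.sum_univ_castSucc, mul_comm]

theorem measurableSet_mulVec_image {d : ℕ} {A : Matrix (Fin d) (Fin d) ℝ} (hA : IsUnit A.det)
    {s : Set (Fin d → ℝ)} (hs : MeasurableSet s) :
    MeasurableSet {y : Fin d → ℝ | ∃ t : Fin d → ℝ, t ∈ s ∧ y = A.mulVec t} := by
  have : {y : Fin d → ℝ | ∃ t : Fin d → ℝ, t ∈ s ∧ y = A.mulVec t} =
      (fun y => A⁻¹.mulVec y) ⁻¹' s := by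
    ext y
    constructor
    · rintro ⟨t, ht, rfl⟩
      simpa [Matrix.mulVec_mulVec, Matrix.nonsing_inv_mul _ hA] using ht
    · intro hy
      exact ⟨_, hy, by rw [Matrix.mulVec_mulVec, Matrix.mul_nonsing_inv _ hA, Matrix.one_mulVec]⟩
  rw [this]
  have hc : Continuous fun y : Fin d → ℝ => A⁻¹.mulVec y := by fun_prop
  exact hc.measurable hs

theorem boxSplineAux_nonneg (d n : ℕ) (Ξ : Matrix (Fin d) (Fin (d + n)) ℝ) (x : Fin d → ℝ) :
    0 ≤ boxSplineAux d n Ξ x := by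
  induction n generalizing x with
  | zero =>
    simp only [boxSplineAux]
    exact Set.indicator_nonneg (fun _ _ => by positivity) x
  | succ n ih =>
    simp only [boxSplineAux]
    exact intervalIntegral.integral_nonneg (by norm_num) fun t _ => ih _ _

theorem boxSplineAux_le (d n : ℕ) (Ξ : Matrix (Fin d) (Fin (d + n)) ℝ) (x : Fin d → ℝ) :
    boxSplineAux d n Ξ x ≤ |(leadingBlock Ξ).det|⁻¹ := by
  induction n generalizing x with
  | zero =>
    simp only [boxSplineAux]
    exact Set.indicator_le_self' (fun _ _ => by positivity) x
  | succ n ih =>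
    simp only [boxSplineAux]
    refine (le_abs_self _).trans ?_
    rw [← Real.norm_eq_abs]
    refine (intervalIntegral.norm_integral_le_of_norm_le_const
      (C := |(leadingBlock Ξ).det|⁻¹) fun t _ => ?_).trans ?_
    · exact (Real.norm_of_nonneg (boxSplineAux_nonneg _ _ _ _)).trans_le (ih _ _)
    · norm_num

theorem measurable_boxSplineAux {d n : ℕ} {Ξ : Matrix (Fin d) (Fin (d + n)) ℝ}
    (hΞ : IsUnit (leadingBlock Ξ).det) : Measurable (boxSplineAux d n Ξ) := by
  induction n with
  | zero =>
    unfold boxSplineAux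
    refine measurable_const.indicator ?_
    have hs : MeasurableSet {t : Fin d → ℝ | ∀ i, t i ∈ Set.Ico (-(1:ℝ)/2) (1/2)} := by
      rw [Set.ofPred_forall]
      exact MeasurableSet.iInter fun i => measurable_pi_apply i measurableSet_Ico
    exact measurableSet_mulVec_image hΞ hs
  | succ n ih =>
    have hm : Measurable (boxSplineAux d n fun i j => Ξ i (Fin.castSucc j)) := ih hΞ
    unfold boxSplineAux
    have h2 : (-(1:ℝ)/2) ≤ 1/2 := by norm_num
    simp only [intervalIntegral.integral_of_le h2]
    have h : Measurable fun p : (Fin d → ℝ) × ℝ =>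
        boxSplineAux d n (fun i j => Ξ i (Fin.castSucc j))
          (p.1 - p.2 • fun i => Ξ i (Fin.last (d + n))) := hm.comp (by fun_prop)
    exact h.stronglyMeasurable.integral_prod_right'.measurable

theorem exists_mulVec_eq_of_boxSplineAux_ne_zero {d n : ℕ} {Ξ : Matrix (Fin d) (Fin (d + n)) ℝ}
    {x : Fin d → ℝ} (hx : boxSplineAux d n Ξ x ≠ 0) :
    ∃ t : Fin (d + n) → ℝ, (∀ i, t i ∈ Set.Icc (-(1:ℝ)/2) (1/2)) ∧ x = Ξ.mulVec t := by
  induction n generalizing x with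
  | zero =>
    simp only [boxSplineAux] at hx
    obtain ⟨t, ht, rfl⟩ := Set.mem_of_indicator_ne_zero hx
    exact ⟨t, fun i => Set.Ico_subset_Icc_self (ht i), rfl⟩
  | succ n ih =>
    have hs : ∃ s ∈ Set.Icc (-(1:ℝ)/2) (1/2),
        boxSplineAux d n (fun i j => Ξ i (Fin.castSucc j))
          (x - s • fun i => Ξ i (Fin.last (d + n))) ≠ 0 := by
      by_contra! h
      apply hx
      simp only [boxSplineAux]
      refine intervalIntegral.integral_zero_ae (Filter.Eventually.of_forall fun s hs => h s ?_)
      rw [Set.uIoc_of_le (by norm_num)] at hs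
      exact Set.Ioc_subset_Icc_self hs
    obtain ⟨s, hs, hne⟩ := hs
    obtain ⟨t, ht, hxt⟩ := ih hne
    refine ⟨Fin.snoc (α := fun _ => ℝ) t s, fun i => ?_, ?_⟩
    · refine Fin.lastCases ?_ (fun j => ?_) i
      · simpa using hs
      · simpa using ht j
    · refine Eq.trans ?_ (mulVec_eq_castSucc_add_last (n := d + n) Ξ _).symm
      simp only [Fin.snoc_castSucc]
      rw [← hxt]
      erw [Fin.snoc_last]
      exact (sub_add_cancel _ _).symm

theorem boxSplineAux_mulVec_pos {d n : ℕ} {Ξ : Matrix (Fin d) (Fin (d + n)) ℝ}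
    (hΞ : IsUnit (leadingBlock Ξ).det) {t : Fin (d + n) → ℝ}
    (ht : ∀ i, t i ∈ Set.Ioo (-(1:ℝ)/2) (1/2)) : 0 < boxSplineAux d n Ξ (Ξ.mulVec t) := by
  induction n with
  | zero =>
    simp only [boxSplineAux]
    rw [Set.indicator_of_mem]
    · exact inv_pos.2 (abs_pos.2 hΞ.ne_zero)
    · exact ⟨t, fun i => Set.Ioo_subset_Ico_self (ht i), rfl⟩
  | succ n ih =>
    set Ξ' : Matrix (Fin d) (Fin (d + n)) ℝ := fun i j => Ξ i (Fin.castSucc j)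
    have hu : IsUnit (leadingBlock Ξ').det := hΞ
    set ξ : Fin d → ℝ := fun i => Ξ i (Fin.last (d + n))
    set t' : Fin (d + n) → ℝ := fun j => t (Fin.castSucc j)
    set r : ℝ := t (Fin.last (d + n))
    obtain ⟨c, hc⟩ := exists_mulVec_eq_of_isUnit_leadingBlock hu ξ
    have hsplit : Ξ.mulVec t = Ξ'.mulVec t' + r • ξ :=
      mulVec_eq_castSucc_add_last (n := d + n) Ξ t
    have hshift (s : ℝ) : Ξ.mulVec t - s • ξ = Ξ'.mulVec (t' + (r - s) • c) := by
      rw [hsplit, Matrix.mulVec_add, Matrix.mulVec_smul, hc, sub_smul, add_sub_assoc]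
    let U : Set ℝ := Set.Ioo (-(1:ℝ)/2) (1/2) ∩
      {s | ∀ i, (t' + (r - s) • c) i ∈ Set.Ioo (-(1:ℝ)/2) (1/2)}
    have hU : IsOpen U := by
      refine isOpen_Ioo.inter ?_
      rw [Set.ofPred_forall]
      refine isOpen_iInter_of_finite fun i => isOpen_Ioo.preimage ?_
      simp only [Pi.add_apply, Pi.smul_apply]
      fun_prop
    have hrU : r ∈ U := ⟨ht _, fun i => by simpa using ht (Fin.castSucc i)⟩
    have h2 : (-(1:ℝ)/2) < 1/2 := by norm_num
    have hmeas : Measurable fun s : ℝ => boxSplineAux d n Ξ' (Ξ.mulVec t - s • ξ) :=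
      (measurable_boxSplineAux hu).comp (by fun_prop)
    have hint : IntervalIntegrable (fun s : ℝ => boxSplineAux d n Ξ' (Ξ.mulVec t - s • ξ))
        volume (-(1:ℝ)/2) (1/2) := by
      refine (intervalIntegrable_const (c := |(leadingBlock Ξ').det|⁻¹)).mono_fun
        hmeas.aestronglyMeasurable (Filter.Eventually.of_forall fun s => ?_)
      exact (Real.norm_of_nonneg (boxSplineAux_nonneg _ _ _ _)).trans_le
        ((boxSplineAux_le _ _ _ _).trans (le_abs_self _))
    change 0 < ∫ s in (-(1:ℝ)/2)..(1/2), boxSplineAux d n Ξ' (Ξ.mulVec t - s • ξ)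
    rw [intervalIntegral.integral_pos_iff_support_of_nonneg_ae
      (Filter.Eventually.of_forall fun s => boxSplineAux_nonneg _ _ _ _) hint]
    refine ⟨h2, (hU.measure_pos volume ⟨r, hrU⟩).trans_le (measure_mono fun s hs => ⟨?_, ?_⟩)⟩
    · rw [Function.mem_support, hshift]
      exact (ih hu hs.2).ne'
    · exact Set.Ioo_subset_Ioc_self hs.1

theorem closure_boxSplineAux_ne_zero {d n : ℕ} {Ξ : Matrix (Fin d) (Fin (d + n)) ℝ}
    (hΞ : IsUnit (leadingBlock Ξ).det) :
    closure {x | boxSplineAux d n Ξ x ≠ 0} =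
      Ξ.mulVec '' Set.univ.pi fun _ => Set.Icc (-(1:ℝ)/2) (1/2) := by
  have hcont : Continuous fun t : Fin (d + n) → ℝ => Ξ.mulVec t := by fun_prop
  refine Set.Subset.antisymm (closure_minimal ?_ ?_) ?_
  · intro x hx
    obtain ⟨t, ht, rfl⟩ := exists_mulVec_eq_of_boxSplineAux_ne_zero hx
    exact ⟨t, fun i _ => ht i, rfl⟩
  · exact ((isCompact_univ_pi fun _ => isCompact_Icc).image hcont).isClosed
  · have h : (Set.univ.pi fun _ : Fin (d + n) => Set.Icc (-(1:ℝ)/2) (1/2)) =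
        closure (Set.univ.pi fun _ => Set.Ioo (-(1:ℝ)/2) (1/2)) := by
      rw [closure_pi_set, closure_Ioo (by norm_num)]
    rw [h]
    refine (image_closure_subset_closure_image hcont).trans (closure_mono ?_)
    rintro _ ⟨t, ht, rfl⟩
    exact (boxSplineAux_mulVec_pos hΞ fun i => ht i trivial).ne'

/-- the topological support of the centered box spline is the zonotope
`Ξ [-1/2,1/2]^m`. -/
theorem boxSpline_support_eq_zonotope {d m : ℕ} (hd : 1 ≤ d) (hdm : d ≤ m)
    (Ξ : Matrix (Fin d) (Fin m) ℝ)
    (hΞ : LinearIndependent ℝ fun j : Fin d => fun i => Ξ i (Fin.castLE hdm j)) :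
    closure {x : Fin d → ℝ | boxSpline hdm Ξ x ≠ 0} =
      {y : Fin d → ℝ | ∃ t : Fin m → ℝ,
        (∀ i, t i ∈ Set.Icc (-(1:ℝ)/2) (1/2)) ∧ y = Ξ.mulVec t} := by
  let e : Fin (d + (m - d)) ≃ Fin m := finCongr (Nat.add_sub_cancel' hdm)
  have hu : IsUnit (leadingBlock (Ξ.submatrix id e)).det := by
    rw [← Matrix.isUnit_iff_isUnit_det, ← Matrix.linearIndependent_cols_iff_isUnit]
    exact hΞ
  have hmul (t : Fin m → ℝ) : (Ξ.submatrix id e).mulVec (t ∘ e) = Ξ.mulVec t := by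
    ext i
    exact Equiv.sum_comp e fun j => Ξ i j * t j
  refine (closure_boxSplineAux_ne_zero hu).trans (Set.ext fun y => ⟨?_, ?_⟩)
  · rintro ⟨t, ht, rfl⟩
    refine ⟨t ∘ e.symm, fun i => ht _ trivial, ?_⟩
    rw [← hmul, Function.comp_assoc, e.symm_comp_self, Function.comp_id]
  · rintro ⟨t, ht, rfl⟩
    exact ⟨t ∘ e, fun i _ => ht _, hmul t⟩
end

section
/- Let d ≤ m, let Ξ be a real d×m matrix whose first d columns are linearly independent, and let r(Ξ) be the minimal number of columns that can be removed from Ξ so that the remaining columns do not span ℝ^d. If r(Ξ) ≥ 2, then the centered box spline M_Ξ is (r(Ξ) − 2)-times continuously differentiable on ℝ^d. -/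
open MeasureTheory

/-- `boxSplineR Ξ` : the minimal number of columns that can be removed from `Ξ` so that
the remaining columns do not span `ℝ^d`. -/
noncomputable def boxSplineR {d m : ℕ} (Ξ : Matrix (Fin d) (Fin m) ℝ) : ℕ :=
  sInf {k : ℕ | ∃ S : Finset (Fin m), S.card = k ∧
    Submodule.span ℝ ((fun j => fun i => Ξ i j) '' (↑Sᶜ : Set (Fin m))) ≠ ⊤}

section DirectionalAverage

variable {E : Type*} [NormedAddCommGroup E] [NormedSpace ℝ E]

/-- The average of the translates of `F` along the segment `[-1/2, 1/2] • v`. -/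
noncomputable def dirAvg (v : E) (F : E → ℝ) : E → ℝ := fun x =>
  ∫ t in (-(1:ℝ)/2)..(1/2), F (x - t • v)

/-- The uniform probability measure on the centered unit interval. -/
noncomputable abbrev centeredUnit : Measure ℝ := volume.restrict (Set.Ioc (-(1:ℝ)/2) (1/2))

theorem dirAvg_apply (v : E) (F : E → ℝ) (x : E) :
    dirAvg v F x = ∫ t, F (x - t • v) ∂centeredUnit :=
  intervalIntegral.integral_of_le (by norm_num)

theorem dirAvg_apply_add (v : E) (F : E → ℝ) (x : E) :
    dirAvg v F x = ∫ t, F (x + t • v) ∂centeredUnit := by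
  have h := intervalIntegral.integral_comp_neg (a := -(1:ℝ)/2) (b := 1/2)
    (fun t => F (x + t • v))
  rw [← intervalIntegral.integral_of_le (by norm_num), dirAvg]
  simp only [neg_smul, ← sub_eq_add_neg] at h
  rw [h]
  norm_num

theorem abs_dirAvg_le (v : E) {F : E → ℝ} {C : ℝ} (hF : ∀ x, |F x| ≤ C) (x : E) :
    |dirAvg v F x| ≤ C := by
  have h := intervalIntegral.norm_integral_le_of_norm_le_const
    (a := -(1:ℝ)/2) (b := 1/2) (f := fun t => F (x - t • v)) fun t _ => hF _
  exact h.trans_eq (by norm_num)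

theorem continuous_dirAvg (v : E) {F : E → ℝ} (hF : Continuous F) :
    Continuous (dirAvg v F) :=
  intervalIntegral.continuous_parametric_intervalIntegral_of_continuous' (by fun_prop) _ _

theorem hasLineDerivAt_dirAvg (v : E) {F : E → ℝ} (hF : Continuous F) (x : E) :
    HasLineDerivAt ℝ (dirAvg v F)
      (F (x + (1/2 : ℝ) • v) - F (x - (1/2 : ℝ) • v)) x v := by
  have hG : Continuous fun u : ℝ => F (x + u • v) := by fun_prop
  have hint : ∀ a b, IntervalIntegrable (fun u : ℝ => F (x + u • v)) volume a b :=
    fun a b => hG.intervalIntegrable a b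
  have key : (fun s : ℝ => dirAvg v F (x + s • v)) = fun s =>
      (∫ u in (0:ℝ)..(s + 1/2), F (x + u • v)) - ∫ u in (0:ℝ)..(s - 1/2), F (x + u • v) := by
    funext s
    rw [intervalIntegral.integral_interval_sub_left (hint _ _) (hint _ _)]
    have h := intervalIntegral.integral_comp_sub_left (a := -(1:ℝ)/2) (b := 1/2)
      (fun u => F (x + u • v)) s
    rw [show s - -(1:ℝ)/2 = s + 1/2 by ring] at h
    rw [← h, dirAvg]
    congr 1
    funext t
    congr 1
    module
  have hd : ∀ c : ℝ, HasDerivAt (fun s : ℝ => ∫ u in (0:ℝ)..(s + c), F (x + u • v))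
      (F (x + c • v)) 0 := by
    intro c
    have h := intervalIntegral.integral_hasDerivAt_right (hint 0 (0 + c))
      (hG.stronglyMeasurableAtFilter _ _) hG.continuousAt
    simpa using h.comp_add_const 0 c
  have h := (hd (1/2)).sub (hd (-(1/2)))
  rw [HasLineDerivAt, key]
  simpa [sub_eq_add_neg] using! h

variable [MeasurableSpace E] [BorelSpace E]

theorem dirAvg_continuousAt (v : E) {F : E → ℝ} {C : ℝ} (hm : Measurable F)
    (hF : ∀ x, |F x| ≤ C) {x : E} (hc : ∀ᵐ t : ℝ, ContinuousAt F (x - t • v)) :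
    ContinuousAt (dirAvg v F) x := by
  refine intervalIntegral.continuousAt_of_dominated_interval (bound := fun _ => C) ?_ ?_ ?_ ?_
  · refine .of_forall fun y => (hm.comp ?_).aestronglyMeasurable
    exact Continuous.measurable (by fun_prop)
  · exact .of_forall fun y => .of_forall fun t _ => hF _
  · exact intervalIntegrable_const
  · filter_upwards [hc] with t ht _
    exact ContinuousAt.comp (f := fun y => y - t • v) ht (by fun_prop)

theorem measurable_dirAvg (v : E) {F : E → ℝ} (hm : Measurable F) : Measurable (dirAvg v F) := by
  have h : Measurable fun p : E × ℝ => F (p.1 - p.2 • v) :=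
    hm.comp (Continuous.measurable (by fun_prop))
  simp only [funext (dirAvg_apply v F)]
  exact (StronglyMeasurable.integral_prod_right
    (f := fun (x : E) (t : ℝ) => F (x - t • v)) h.stronglyMeasurable).measurable

variable {μ : Measure E} [SFinite μ] [μ.IsAddRightInvariant]

theorem integrable_translates (v : E) {F : E → ℝ} (hm : Measurable F) (hF : Integrable F μ) :
    Integrable (fun p : E × ℝ => F (p.1 - p.2 • v)) (μ.prod centeredUnit) := by
  have h : Measurable fun p : E × ℝ => F (p.1 - p.2 • v) :=
    hm.comp (Continuous.measurable (by fun_prop))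
  rw [integrable_prod_iff' h.aestronglyMeasurable]
  refine ⟨.of_forall fun t => hF.comp_sub_right (t • v), ?_⟩
  have : ∀ t : ℝ, ∫ x, ‖F (x - t • v)‖ ∂μ = ∫ x, ‖F x‖ ∂μ := fun t =>
    integral_sub_right_eq_self (fun x => ‖F x‖) (t • v)
  simp only [this]
  exact integrable_const _

theorem integrable_dirAvg (v : E) {F : E → ℝ} (hm : Measurable F) (hF : Integrable F μ) :
    Integrable (dirAvg v F) μ := by
  simp only [funext (dirAvg_apply v F)]
  exact (integrable_translates v hm hF).integral_prod_left

theorem integral_dirAvg_mul (v : E) {F φ : E → ℝ} {C : ℝ} (hm : Measurable F)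
    (hF : Integrable F μ) (hφ : Continuous φ) (hC : ∀ x, |φ x| ≤ C) :
    ∫ x, dirAvg v F x * φ x ∂μ = ∫ x, F x * dirAvg v φ x ∂μ := by
  have h₁ : Integrable (fun p : E × ℝ => F (p.1 - p.2 • v) * φ p.1) (μ.prod centeredUnit) := by
    simp only [mul_comm _ (φ _)]
    exact (integrable_translates v hm hF).bdd_mul (c := C)
      (Continuous.aestronglyMeasurable (by fun_prop)) (.of_forall fun p => hC _)
  have h₂ : Integrable (fun p : E × ℝ => F p.1 * φ (p.1 + p.2 • v)) (μ.prod centeredUnit) := by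
    simp only [mul_comm _ (φ _)]
    exact (hF.comp_fst _).bdd_mul (c := C)
      (Continuous.aestronglyMeasurable (by fun_prop)) (.of_forall fun p => hC _)
  simp only [dirAvg_apply v F, dirAvg_apply_add v φ, ← integral_mul_const, ← integral_const_mul]
  rw [integral_integral_swap (f := fun x t => F (x - t • v) * φ x) h₁,
    integral_integral_swap (f := fun x t => F x * φ (x + t • v)) h₂]
  congr 1
  funext t
  rw [← integral_add_right_eq_self _ (t • v)]
  simp

end DirectionalAverage

section BoundedContinuous

open BoundedContinuousFunction

variable {E : Type*} [NormedAddCommGroup E] [NormedSpace ℝ E]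

/-- `dirAvg` as an operator on bounded continuous functions. -/
noncomputable def dirAvgBCF (v : E) (φ : E →ᵇ ℝ) : E →ᵇ ℝ :=
  .ofNormedAddCommGroup (dirAvg v φ) (continuous_dirAvg v φ.continuous) ‖φ‖
    (abs_dirAvg_le v φ.norm_coe_le_norm)

@[simp]
theorem dirAvgBCF_apply (v : E) (φ : E →ᵇ ℝ) (x : E) : dirAvgBCF v φ x = dirAvg v φ x := rfl

instance : LeftCommutative (dirAvgBCF (E := E)) where
  left_comm v w φ := by
    ext x
    simp only [dirAvgBCF_apply, dirAvg_apply]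
    rw [integral_integral_swap]
    · simp only [sub_right_comm]
    · refine (integrable_const ‖φ‖).mono' (Continuous.aestronglyMeasurable ?_)
        (.of_forall fun p => φ.norm_coe_le_norm _)
      simp only [Function.uncurry_def]
      fun_prop

/-- Iterated directional averages are averages over a cube. -/
theorem foldr_dirAvgBCF_ofFn (φ : E →ᵇ ℝ) : ∀ {n : ℕ} (w : Fin n → E) (x : E),
    (List.ofFn w).foldr dirAvgBCF φ x =
      ∫ t : Fin n → ℝ, φ (x + ∑ i, t i • w i) ∂(Measure.pi fun _ => centeredUnit) := by
  intro n
  induction n with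
  | zero =>
    intro w x
    rw [Measure.pi_of_empty (fun _ : Fin 0 => centeredUnit)]
    simp
  | succ n ih =>
    intro w x
    have hmp := measurePreserving_piFinSuccAbove (fun _ : Fin (n + 1) => centeredUnit) 0
    rw [List.ofFn_succ, List.foldr_cons, dirAvgBCF_apply, dirAvg_apply_add]
    simp only [ih]
    rw [integral_integral (f := fun s (t : Fin n → ℝ) => φ (x + s • w 0 + ∑ i, t i • w i.succ))]
    · rw [← hmp.integral_comp (MeasurableEquiv.measurableEmbedding _)]
      simp [Fin.sum_univ_succ, add_assoc, MeasurableEquiv.piFinSuccAbove, Fin.tail]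
    · refine (integrable_const ‖φ‖).mono' (Continuous.aestronglyMeasurable ?_)
        (.of_forall fun p => φ.norm_coe_le_norm _)
      simp only [Function.uncurry_def]
      fun_prop

end BoundedContinuous

section PartialDerivatives

variable {E : Type*} [NormedAddCommGroup E] [NormedSpace ℝ E]

theorem abs_sub_sub_le_of_hasLineDerivAt {f g : E → ℝ} {v : E}
    (hf : ∀ x, HasLineDerivAt ℝ f (g x) x v) {y : E} {c p ε : ℝ}
    (hg : ∀ t ∈ Set.Icc (0:ℝ) 1, |g (y + (t * c) • v) - p| ≤ ε) :
    |f (y + c • v) - f y - c * p| ≤ ε * |c| := by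
  have hd : ∀ t : ℝ, HasDerivAt (fun t : ℝ => f (y + (t * c) • v) - t * (c * p))
      (c * (g (y + (t * c) • v) - p)) t := by
    intro t
    have h₁ : HasDerivAt (fun s : ℝ => f (y + s • v)) (g (y + (t * c) • v)) (t * c) := by
      have h := hf (y + (t * c) • v)
      rw [HasLineDerivAt] at h
      have h' := HasDerivAt.comp_sub_const (t * c) (t * c) (by simpa using h)
      refine h'.congr_of_eventuallyEq (.of_forall fun s => ?_)
      dsimp only
      congr 1
      module
    have h₂ := h₁.comp t ((hasDerivAt_id t).mul_const c)
    have h₃ := h₂.sub ((hasDerivAt_id t).mul_const (c * p))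
    refine h₃.congr_deriv ?_
    ring
  have h := norm_image_sub_le_of_norm_deriv_le_segment_01' (C := ε * |c|)
    (fun t _ => (hd t).hasDerivWithinAt) (fun t ht => ?_)
  · simpa [Real.norm_eq_abs, sub_right_comm] using h
  · rw [Real.norm_eq_abs, abs_mul, mul_comm]
    exact mul_le_mul_of_nonneg_right (hg t ⟨ht.1, ht.2.le⟩) (abs_nonneg c)

/-- A function with continuous line derivatives along a basis is differentiable. -/
theorem hasFDerivAt_of_hasLineDerivAt_basis [FiniteDimensional ℝ E] {ι : Type*} [Fintype ι]
    (b : Module.Basis ι ℝ E) {f : E → ℝ} {g : ι → E → ℝ} (hg : ∀ i, Continuous (g i))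
    (hf : ∀ i x, HasLineDerivAt ℝ f (g i x) x (b i)) (x : E) :
    HasFDerivAt f (∑ i, g i x • LinearMap.toContinuousLinearMap (b.coord i)) x := by
  classical
  have hc : ∀ i, Continuous fun h : E => b.repr h i := fun i =>
    (LinearMap.toContinuousLinearMap (b.coord i)).continuous
  have key : ∀ s : Finset ι, (fun h : E => f (x + ∑ i ∈ s, b.repr h i • b i) - f x -
      ∑ i ∈ s, b.repr h i * g i x) =o[nhds 0] fun h => h := by
    intro s
    induction s using Finset.induction_on with
    | empty => simp
    | insert a s ha ih =>
      have hO : (fun h : E => b.repr h a) =O[nhds 0] fun h => h :=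
        (LinearMap.toContinuousLinearMap (b.coord a)).isBigO_id _
      have step : (fun h : E => f (x + ∑ i ∈ s, b.repr h i • b i + b.repr h a • b a) -
          f (x + ∑ i ∈ s, b.repr h i • b i) - b.repr h a * g a x) =o[nhds 0]
          fun h => b.repr h a := by
        rw [Asymptotics.isLittleO_iff]
        intro ε hε
        obtain ⟨δ, hδ, hball⟩ := Metric.continuousAt_iff.1 ((hg a).continuousAt (x := x)) ε hε
        have hlim : Filter.Tendsto (fun h : E => ‖∑ i ∈ s, b.repr h i • b i‖ +
            |b.repr h a| * ‖b a‖) (nhds 0) (nhds 0) := by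
          have : Continuous fun h : E => ‖∑ i ∈ s, b.repr h i • b i‖ +
            |b.repr h a| * ‖b a‖ := by fun_prop
          simpa using this.tendsto 0
        filter_upwards [hlim.eventually_lt_const hδ] with h hh
        refine abs_sub_sub_le_of_hasLineDerivAt (hf a) fun t ht => ?_
        refine (hball ?_).le
        rw [dist_eq_norm, add_assoc, add_sub_cancel_left]
        refine ((norm_add_le _ _).trans (add_le_add le_rfl ?_)).trans_lt hh
        rw [norm_smul, Real.norm_eq_abs, abs_mul, abs_of_nonneg ht.1]
        gcongr
        exact mul_le_of_le_one_left (abs_nonneg _) ht.2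
      refine (ih.add (step.trans_isBigO hO)).congr_left fun h => ?_
      rw [Finset.sum_insert ha, Finset.sum_insert ha,
        add_comm (b.repr h a • b a), add_assoc x]
      ring
  rw [hasFDerivAt_iff_isLittleO_nhds_zero]
  refine (key Finset.univ).congr_left fun h => ?_
  rw [b.sum_repr]
  simp [mul_comm]

theorem contDiff_succ_of_hasLineDerivAt_basis [FiniteDimensional ℝ E] {ι : Type*} [Fintype ι]
    (b : Module.Basis ι ℝ E) {k : ℕ} {f : E → ℝ} {g : ι → E → ℝ}
    (hg : ∀ i, ContDiff ℝ k (g i)) (hf : ∀ i x, HasLineDerivAt ℝ f (g i x) x (b i)) :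
    ContDiff ℝ (k + 1 : ℕ) f := by
  rw [Nat.cast_add, Nat.cast_one, contDiff_succ_iff_hasFDerivAt]
  exact ⟨_, ContDiff.sum fun i _ => (hg i).smul contDiff_const, fun x =>
    hasFDerivAt_of_hasLineDerivAt_basis b (fun i => (hg i).continuous) hf x⟩

end PartialDerivatives

section CubeSpline

open BoundedContinuousFunction Module

variable {d : ℕ}

/-- The normalized indicator function of the half-open centered parallelepiped spanned by `b`. -/
noncomputable def basisIndicator (b : Basis (Fin d) ℝ (Fin d → ℝ)) : (Fin d → ℝ) → ℝ :=
  Set.indicator {y | ∀ i, b.repr y i ∈ Set.Ico (-(1:ℝ)/2) (1/2)}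
    fun _ => |(Matrix.of fun i j => b j i).det|⁻¹

theorem basisIndicator_of_mem (b : Basis (Fin d) ℝ (Fin d → ℝ)) {x : Fin d → ℝ}
    (hx : ∀ i, b.repr x i ∈ Set.Ico (-(1:ℝ)/2) (1/2)) :
    basisIndicator b x = |(Matrix.of fun i j => b j i).det|⁻¹ :=
  Set.indicator_of_mem (s := {y | ∀ i, b.repr y i ∈ Set.Ico (-(1:ℝ)/2) (1/2)}) hx _

theorem basisIndicator_of_notMem (b : Basis (Fin d) ℝ (Fin d → ℝ)) {x : Fin d → ℝ}
    (hx : ¬ ∀ i, b.repr x i ∈ Set.Ico (-(1:ℝ)/2) (1/2)) :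
    basisIndicator b x = 0 :=
  Set.indicator_of_notMem (s := {y | ∀ i, b.repr y i ∈ Set.Ico (-(1:ℝ)/2) (1/2)}) hx _

theorem continuous_repr (b : Basis (Fin d) ℝ (Fin d → ℝ)) (i : Fin d) :
    Continuous fun y => b.repr y i :=
  (LinearMap.toContinuousLinearMap (b.coord i)).continuous

theorem measurableSet_parallelepiped (b : Basis (Fin d) ℝ (Fin d → ℝ)) :
    MeasurableSet {y | ∀ i, b.repr y i ∈ Set.Ico (-(1:ℝ)/2) (1/2)} := by
  rw [Set.ofPred_forall]
  exact .iInter fun i => (continuous_repr b i).measurable measurableSet_Ico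

theorem measurable_basisIndicator (b : Basis (Fin d) ℝ (Fin d → ℝ)) :
    Measurable (basisIndicator b) :=
  measurable_const.indicator (measurableSet_parallelepiped b)

theorem abs_basisIndicator_le (b : Basis (Fin d) ℝ (Fin d → ℝ)) (x : Fin d → ℝ) :
    |basisIndicator b x| ≤ |(Matrix.of fun i j => b j i).det|⁻¹ := by
  by_cases hx : ∀ i, b.repr x i ∈ Set.Ico (-(1:ℝ)/2) (1/2)
  · simp [basisIndicator_of_mem b hx]
  · simp [basisIndicator_of_notMem b hx]

theorem integrable_basisIndicator (b : Basis (Fin d) ℝ (Fin d → ℝ)) :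
    Integrable (basisIndicator b) := by
  refine IntegrableOn.integrable_indicator (integrableOn_const ?_) (measurableSet_parallelepiped b)
  have hK : IsCompact (b.equivFun.symm '' Set.univ.pi fun _ => Set.Icc (-(1:ℝ)/2) (1/2)) :=
    (isCompact_univ_pi fun _ => isCompact_Icc).image
      b.equivFun.symm.toContinuousLinearEquiv.continuous
  refine ((measure_mono fun y hy => ?_).trans_lt hK.measure_lt_top).ne
  exact ⟨b.equivFun y, fun i _ => ⟨(hy i).1, (hy i).2.le⟩, by simp⟩

theorem continuousAt_basisIndicator (b : Basis (Fin d) ℝ (Fin d → ℝ)) {x : Fin d → ℝ}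
    (hx : ∀ i, b.repr x i ≠ -(1:ℝ)/2 ∧ b.repr x i ≠ 1/2) :
    ContinuousAt (basisIndicator b) x := by
  by_cases h : ∀ i, b.repr x i ∈ Set.Ico (-(1:ℝ)/2) (1/2)
  · have hev : ∀ᶠ y in nhds x, ∀ i, b.repr y i ∈ Set.Ico (-(1:ℝ)/2) (1/2) :=
      Filter.eventually_all.2 fun i => (continuous_repr b i).continuousAt.eventually
        (Ico_mem_nhds ((h i).1.lt_of_ne (hx i).1.symm) (h i).2)
    refine continuousAt_const.congr (f := fun _ => |(Matrix.of fun i j => b j i).det|⁻¹) ?_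
    filter_upwards [hev] with y hy
    exact (basisIndicator_of_mem b hy).symm
  · obtain ⟨i, hi⟩ := not_forall.1 h
    have hx' : b.repr x i ∈ (Set.Icc (-(1:ℝ)/2) (1/2))ᶜ := fun h' =>
      hi ⟨h'.1, h'.2.lt_of_ne (hx i).2⟩
    refine continuousAt_const.congr (f := fun _ => 0) ?_
    filter_upwards [(continuous_repr b i).continuousAt.eventually
      (isClosed_Icc.isOpen_compl.mem_nhds hx')] with y hy
    exact (basisIndicator_of_notMem b fun h' => hy ⟨(h' i).1, (h' i).2.le⟩).symm

theorem det_basis_ne_zero (b : Basis (Fin d) ℝ (Fin d → ℝ)) :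
    (Matrix.of fun i j => b j i).det ≠ 0 := by
  have h := (Pi.basisFun ℝ (Fin d)).isUnit_det b
  rw [Basis.det_apply] at h
  convert h.ne_zero using 2
  ext i j
  simp [Basis.toMatrix_apply]

theorem integral_basisIndicator_mul (b : Basis (Fin d) ℝ (Fin d → ℝ)) (φ : (Fin d → ℝ) →ᵇ ℝ) :
    ∫ x, basisIndicator b x * φ x = (List.ofFn b).foldr dirAvgBCF φ 0 := by
  set M : Matrix (Fin d) (Fin d) ℝ := Matrix.of fun i j => b j i with hM
  have hdet : M.det ≠ 0 := det_basis_ne_zero b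
  have hmulVec : ∀ t, Matrix.toLin' M t = ∑ i, t i • b i := by
    intro t
    ext k
    simp [hM, Matrix.mulVec, dotProduct, mul_comm]
  have hmap := Real.map_matrix_volume_pi_eq_smul_volume_pi hdet
  have hmeas : Measurable (Matrix.toLin' M) :=
    (LinearMap.continuous_of_finiteDimensional _).measurable
  have hg : Measurable fun x => basisIndicator b x * φ x :=
    (measurable_basisIndicator b).mul φ.continuous.measurable
  have h₁ : ∫ t, basisIndicator b (Matrix.toLin' M t) * φ (Matrix.toLin' M t) =
      |M.det|⁻¹ * ∫ x, basisIndicator b x * φ x := by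
    rw [← integral_map (f := fun x => basisIndicator b x * φ x) hmeas.aemeasurable
      hg.aestronglyMeasurable, hmap, integral_smul_measure,
      ENNReal.toReal_ofReal (abs_nonneg _), abs_inv, smul_eq_mul]
  have h₂ : ∀ t, basisIndicator b (Matrix.toLin' M t) * φ (Matrix.toLin' M t) =
      (Set.univ.pi fun _ => Set.Ico (-(1:ℝ)/2) (1/2)).indicator
        (fun t => |M.det|⁻¹ * φ (0 + ∑ i, t i • b i)) t := by
    intro t
    rw [hmulVec]
    by_cases ht : ∀ i, t i ∈ Set.Ico (-(1:ℝ)/2) (1/2)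
    · rw [basisIndicator_of_mem b (by simpa only [b.repr_sum_self] using ht),
        Set.indicator_of_mem (by simpa using ht), zero_add]
    · rw [basisIndicator_of_notMem b (by simpa only [b.repr_sum_self] using ht),
        Set.indicator_of_notMem (by simpa using ht), zero_mul]
  have hcube : (volume : Measure (Fin d → ℝ)).restrict
      (Set.univ.pi fun _ => Set.Ico (-(1:ℝ)/2) (1/2)) = Measure.pi fun _ => centeredUnit := by
    rw [volume_pi, Measure.restrict_pi_pi]
    simp only [centeredUnit, restrict_Ico_eq_restrict_Ioc]
  rw [foldr_dirAvgBCF_ofFn]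
  simp only [h₂] at h₁
  rw [integral_indicator (.univ_pi fun _ => measurableSet_Ico), hcube, integral_const_mul] at h₁
  exact (mul_left_cancel₀ (inv_ne_zero (abs_ne_zero.2 hdet)) h₁).symm

/-- The box spline with directions `b` and `L`, where `b` is a basis. -/
noncomputable def cubeSpline (b : Basis (Fin d) ℝ (Fin d → ℝ)) (L : List (Fin d → ℝ)) :
    (Fin d → ℝ) → ℝ :=
  L.foldr dirAvg (basisIndicator b)

theorem measurable_cubeSpline (b : Basis (Fin d) ℝ (Fin d → ℝ)) :
    ∀ L, Measurable (cubeSpline b L)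
  | [] => measurable_basisIndicator b
  | v :: L => measurable_dirAvg v (measurable_cubeSpline b L)

theorem abs_cubeSpline_le (b : Basis (Fin d) ℝ (Fin d → ℝ)) :
    ∀ L x, |cubeSpline b L x| ≤ |(Matrix.of fun i j => b j i).det|⁻¹
  | [] => abs_basisIndicator_le b
  | v :: L => abs_dirAvg_le v (abs_cubeSpline_le b L)

theorem integrable_cubeSpline (b : Basis (Fin d) ℝ (Fin d → ℝ)) :
    ∀ L, Integrable (cubeSpline b L)
  | [] => integrable_basisIndicator b
  | v :: L => integrable_dirAvg v (measurable_cubeSpline b L) (integrable_cubeSpline b L)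

theorem integral_cubeSpline_mul (b : Basis (Fin d) ℝ (Fin d → ℝ)) (L : List (Fin d → ℝ))
    (φ : (Fin d → ℝ) →ᵇ ℝ) :
    ∫ x, cubeSpline b L x * φ x = (List.ofFn b ++ L).foldr dirAvgBCF φ 0 := by
  induction L generalizing φ with
  | nil => simpa [cubeSpline] using integral_basisIndicator_mul b φ
  | cons v L ih =>
    have hp : (List.ofFn b ++ v :: L).Perm ((List.ofFn b ++ L) ++ [v]) :=
      List.perm_middle.trans (List.perm_append_singleton _ _).symm
    rw [hp.foldr_eq, List.foldr_append, List.foldr_cons, List.foldr_nil, ← ih]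
    exact integral_dirAvg_mul v (measurable_cubeSpline b L) (integrable_cubeSpline b L)
      φ.continuous φ.norm_coe_le_norm

/-- A continuous box spline depends only on the multiset of directions. -/
theorem cubeSpline_eq_of_perm {b b' : Basis (Fin d) ℝ (Fin d → ℝ)} {L L' : List (Fin d → ℝ)}
    (hp : (List.ofFn b ++ L).Perm (List.ofFn b' ++ L'))
    (hc : Continuous (cubeSpline b L)) (hc' : Continuous (cubeSpline b' L')) :
    cubeSpline b L = cubeSpline b' L' := by
  refine (Continuous.ae_eq_iff_eq volume hc hc').1 ?_
  refine ae_eq_of_integral_contDiff_smul_eq (integrable_cubeSpline b L).locallyIntegrable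
    (integrable_cubeSpline b' L').locallyIntegrable fun g hg hgc => ?_
  obtain ⟨C, hC⟩ := hgc.exists_bound_of_continuous hg.continuous
  let φ : (Fin d → ℝ) →ᵇ ℝ := .ofNormedAddCommGroup g hg.continuous C hC
  have h := (integral_cubeSpline_mul b L φ).trans
    ((congrArg (fun ψ => ψ 0) (hp.foldr_eq φ)).trans (integral_cubeSpline_mul b' L' φ).symm)
  simpa only [smul_eq_mul, mul_comm (g _)] using! h

/-- If every direction of `L` lies in the kernel of the `i`-th coordinate, then the spline may jump
where that coordinate is `±1/2`; there are no other discontinuities. -/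
theorem continuousAt_cubeSpline (b : Basis (Fin d) ℝ (Fin d → ℝ)) (L : List (Fin d → ℝ))
    {x : Fin d → ℝ} (hx : ∀ i, (∀ v ∈ L, b.repr v i = 0) →
      b.repr x i ≠ -(1:ℝ)/2 ∧ b.repr x i ≠ 1/2) :
    ContinuousAt (cubeSpline b L) x := by
  induction L generalizing x with
  | nil => exact continuousAt_basisIndicator b fun i => hx i (by simp)
  | cons v L ih =>
    refine dirAvg_continuousAt v (measurable_cubeSpline b L) (abs_cubeSpline_le b L) ?_
    have hfin : ∀ᵐ t : ℝ, ∀ i, (b.repr x i - t * b.repr v i = -(1:ℝ)/2 ∨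
        b.repr x i - t * b.repr v i = 1/2) → b.repr v i = 0 := by
      rw [ae_all_iff]
      intro i
      by_cases hv : b.repr v i = 0
      · simp [hv]
      · have h₁ := Measure.ae_ne volume ((b.repr x i - -(1:ℝ)/2) / b.repr v i)
        have h₂ := Measure.ae_ne volume ((b.repr x i - (1:ℝ)/2) / b.repr v i)
        filter_upwards [h₁, h₂] with t ht₁ ht₂ h
        refine (h.elim (fun h => ht₁ ?_) fun h => ht₂ ?_).elim
        · rw [← h]; field_simp; ring
        · rw [← h]; field_simp; ring
    filter_upwards [hfin] with t ht
    refine ih fun i hi => ?_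
    have hrepr : b.repr (x - t • v) i = b.repr x i - t * b.repr v i := by simp
    by_contra hne
    rw [hrepr] at hne
    have hor := by rwa [← not_or, not_not] at hne
    have hv := ht i hor
    simp only [hv, mul_zero, sub_zero] at hor
    have := hx i (by simpa [hv] using hi)
    tauto

end CubeSpline

section SpanningLists

variable {E : Type*} [AddCommGroup E] [Module ℝ E]

/-- The vectors in `T` still span after the removal of fewer than `k` of them. -/
def SpansAfterRemoving (k : ℕ) (T : List E) : Prop :=
  ∀ W : List E, W.Subperm T → T.length < W.length + k → Submodule.span ℝ {x | x ∈ W} = ⊤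

theorem SpansAfterRemoving.mono {k k' : ℕ} {T : List E} (h : SpansAfterRemoving k' T)
    (hk : k ≤ k') : SpansAfterRemoving k T :=
  fun W hW hlen => h W hW (by omega)

theorem SpansAfterRemoving.perm {k : ℕ} {T T' : List E} (h : SpansAfterRemoving k T)
    (hp : T'.Perm T) : SpansAfterRemoving k T' :=
  fun W hW hlen => h W (hW.trans hp.subperm) (hp.length_eq ▸ hlen)

theorem SpansAfterRemoving.of_cons {k : ℕ} {v : E} {T : List E}
    (h : SpansAfterRemoving (k + 1) (v :: T)) : SpansAfterRemoving k T :=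
  fun W hW hlen => h W (hW.trans (List.sublist_cons_self v T).subperm) (by
    rw [List.length_cons]; omega)

theorem SpansAfterRemoving.span_eq_top {k : ℕ} {T : List E}
    (h : SpansAfterRemoving (k + 1) T) : Submodule.span ℝ {x | x ∈ T} = ⊤ :=
  h T (List.Subperm.refl T) (by omega)

/-- A spanning list can be permuted so that it starts with a basis. -/
theorem exists_basis_append_perm {d : ℕ} [FiniteDimensional ℝ E] (hd : Module.finrank ℝ E = d)
    {T : List E} (hT : Submodule.span ℝ {x | x ∈ T} = ⊤) :
    ∃ (b : Module.Basis (Fin d) ℝ E) (L : List E), T.Perm (List.ofFn b ++ L) := by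
  obtain ⟨s, hsT, hspan, hli⟩ := exists_linearIndependent ℝ {x | x ∈ T}
  let b₀ : Module.Basis s ℝ E := Module.Basis.mk hli (by simp [hspan, hT])
  have : Finite s := Module.Finite.finite_basis b₀
  have : Fintype s := Fintype.ofFinite s
  have e : s ≃ Fin d := Fintype.equivFinOfCardEq (by
    rw [← Module.finrank_eq_card_basis b₀, hd])
  let b := b₀.reindex e
  have hb : (List.ofFn b).Subperm T := by
    refine (List.nodup_ofFn.2 b.injective).subperm fun x hx => ?_
    obtain ⟨i, rfl⟩ := (List.mem_ofFn' _ _).1 hx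
    simpa [b, b₀] using hsT (e.symm i).2
  obtain ⟨l, hl, hlT⟩ := hb
  obtain ⟨L, hL⟩ := hlT.exists_perm_append
  exact ⟨b, L, hL.trans (hl.append_right L)⟩

end SpanningLists

section Smoothness

open Module

variable {d : ℕ}

theorem continuous_cubeSpline {b : Basis (Fin d) ℝ (Fin d → ℝ)} {L : List (Fin d → ℝ)}
    (h : SpansAfterRemoving 2 (List.ofFn b ++ L)) : Continuous (cubeSpline b L) := by
  refine continuous_iff_continuousAt.2 fun x => continuousAt_cubeSpline b L fun i hi => ?_
  exfalso
  obtain ⟨W, hb⟩ : ∃ W, (List.ofFn b).Perm (b i :: W) :=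
    ⟨_, List.perm_cons_erase ((List.mem_ofFn' _ _).2 ⟨i, rfl⟩)⟩
  have hW : (List.ofFn b ++ L).Perm (b i :: (W ++ L)) := hb.append_right L
  have hnodup : (b i :: W).Nodup := hb.nodup_iff.1 (List.nodup_ofFn.2 b.injective)
  have hspan := (h.perm hW.symm) (W ++ L) (List.sublist_cons_self _ _).subperm (by simp)
  have hle : Submodule.span ℝ {x | x ∈ W ++ L} ≤ LinearMap.ker (b.coord i) := by
    refine Submodule.span_le.2 fun v hv => ?_
    rcases List.mem_append.1 hv with hv | hv
    · have hmem : v ∈ List.ofFn b := hb.mem_iff.2 (by simp [hv])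
      obtain ⟨j, rfl⟩ := (List.mem_ofFn' _ _).1 hmem
      have hne : j ≠ i := by
        rintro rfl
        exact (List.nodup_cons.1 hnodup).1 hv
      simp [hne]
    · exact hi v hv
  have hmem : b i ∈ LinearMap.ker (b.coord i) := hle (hspan ▸ Submodule.mem_top)
  simp at hmem

theorem contDiff_cubeSpline {k : ℕ} {b : Basis (Fin d) ℝ (Fin d → ℝ)} {L : List (Fin d → ℝ)}
    (h : SpansAfterRemoving (k + 2) (List.ofFn b ++ L)) : ContDiff ℝ k (cubeSpline b L) := by
  induction k generalizing b L with
  | zero => exact contDiff_zero.2 (continuous_cubeSpline h)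
  | succ k ih =>
    have hdir : ∀ i, ∃ G : (Fin d → ℝ) → ℝ, ContDiff ℝ k G ∧ cubeSpline b L = dirAvg (b i) G := by
      intro i
      have hmem : b i ∈ List.ofFn b ++ L :=
        List.mem_append_left _ ((List.mem_ofFn' _ _).2 ⟨i, rfl⟩)
      have hp := List.perm_cons_erase hmem
      have hT := (h.perm hp.symm).of_cons
      obtain ⟨b', L', hp'⟩ := exists_basis_append_perm (Module.finrank_fin_fun ℝ) hT.span_eq_top
      have hG := ih (hT.perm hp'.symm)
      refine ⟨cubeSpline b' L', hG, ?_⟩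
      exact cubeSpline_eq_of_perm (L' := b i :: L')
        (hp.trans ((hp'.cons _).trans List.perm_middle.symm))
        (continuous_cubeSpline (h.mono (by omega))) (continuous_dirAvg _ hG.continuous)
    choose G hG hGeq using hdir
    refine contDiff_succ_of_hasLineDerivAt_basis b
      (g := fun i x => G i (x + (1/2 : ℝ) • b i) - G i (x - (1/2 : ℝ) • b i))
      (fun i => ?_) fun i x => ?_
    · exact ((hG i).comp (contDiff_id.add contDiff_const)).sub
        ((hG i).comp (contDiff_id.sub contDiff_const))
    · rw [hGeq i]
      exact hasLineDerivAt_dirAvg (b i) (hG i).continuous x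

end Smoothness

theorem boxSplineAux_eq_cubeSpline {d : ℕ} (b : Module.Basis (Fin d) ℝ (Fin d → ℝ)) :
    ∀ (n : ℕ) (Ξ : Matrix (Fin d) (Fin (d + n)) ℝ),
      (∀ j i, Ξ i (Fin.castAdd n j) = b j i) →
      ∃ L, boxSplineAux d n Ξ = cubeSpline b L ∧
        (List.ofFn fun j i => Ξ i j).Perm (List.ofFn b ++ L) := by
  intro n
  induction n with
  | zero =>
    intro Ξ hΞ
    refine ⟨[], ?_, ?_⟩
    · have hM : (Matrix.of fun (i j : Fin d) => Ξ i (Fin.cast (Nat.add_zero d).symm j)) =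
          Matrix.of fun i j => b j i := by
        ext i j
        exact hΞ j i
      have hmulVec : ∀ t, (Matrix.of fun i j => b j i).mulVec t = ∑ i, t i • b i := by
        intro t
        ext k
        simp [Matrix.mulVec, dotProduct, mul_comm]
      funext x
      simp only [boxSplineAux, hM, cubeSpline, List.foldr_nil, basisIndicator, hmulVec]
      congr 1
      ext y
      constructor
      · rintro ⟨t, ht, rfl⟩ i
        rw [b.repr_sum_self]
        exact ht i
      · intro hy
        exact ⟨b.repr y, hy, (b.sum_repr y).symm⟩
    · rw [List.append_nil]
      refine .of_eq (congrArg List.ofFn ?_)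
      funext j i
      exact hΞ j i
  | succ n ih =>
    intro Ξ hΞ
    obtain ⟨L, hL, hp⟩ := ih (fun i j => Ξ i (Fin.castSucc j)) hΞ
    refine ⟨(fun i => Ξ i (Fin.last (d + n))) :: L, ?_, ?_⟩
    · funext x
      simp only [boxSplineAux, hL]
      rfl
    · have h := List.ofFn_succ' (n := d + n) fun (j : Fin (d + n + 1)) i => Ξ i j
      refine (List.Perm.of_eq h).trans ?_
      rw [List.concat_eq_append]
      exact (List.perm_append_singleton _ _).trans ((hp.cons _).trans List.perm_middle.symm)

theorem spansAfterRemoving_columns {d m : ℕ} (Ξ : Matrix (Fin d) (Fin m) ℝ) :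
    SpansAfterRemoving (boxSplineR Ξ) (List.ofFn fun j i => Ξ i j) := by
  rintro W ⟨W', hp, hsub⟩ hlen
  rw [List.ofFn_eq_map, List.sublist_map_iff] at hsub
  obtain ⟨u, hu, rfl⟩ := hsub
  have hnodup : u.Nodup := hu.nodup (List.nodup_finRange m)
  have hcard : u.toFinset.card = W.length := by
    rw [List.toFinset_card_of_nodup hnodup, ← hp.length_eq, List.length_map]
  rw [List.length_ofFn] at hlen
  have hlt : (u.toFinsetᶜ).card < boxSplineR Ξ := by
    rw [Finset.card_compl, hcard, Fintype.card_fin]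
    have : u.toFinset.card ≤ m := by simpa using u.toFinset.card_le_univ
    omega
  have h := Nat.notMem_of_lt_sInf hlt
  simp only [Set.mem_ofPred_eq, not_exists, not_and, not_not] at h
  rw [← h _ rfl, compl_compl]
  congr 1
  ext x
  simp [← hp.mem_iff]

/-- the centered box spline is `(r(Ξ) - 2)`-times continuously
differentiable, where `r(Ξ)` is the minimal number of columns whose removal leaves
columns not spanning `ℝ^d`. -/
theorem boxSpline_smoothness {d m : ℕ} (hd : 1 ≤ d) (hdm : d ≤ m)
    (Ξ : Matrix (Fin d) (Fin m) ℝ)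
    (hΞ : LinearIndependent ℝ fun j : Fin d => fun i => Ξ i (Fin.castLE hdm j))
    (hr : 2 ≤ boxSplineR Ξ) :
    ContDiff ℝ (boxSplineR Ξ - 2 : ℕ) (boxSpline hdm Ξ) := by
  let b : Module.Basis (Fin d) ℝ (Fin d → ℝ) :=
    basisOfLinearIndependentOfCardEqFinrank' _ hΞ (by simp)
  obtain ⟨L, hL, hp⟩ := boxSplineAux_eq_cubeSpline b (m - d)
    (fun i j => Ξ i (Fin.cast (Nat.add_sub_cancel' hdm) j)) (fun j i => by simp [b]; rfl)
  have hcols : (List.ofFn fun j i => Ξ i (Fin.cast (Nat.add_sub_cancel' hdm) j)) =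
      List.ofFn fun j i => Ξ i j :=
    (List.ofFn_congr (Nat.add_sub_cancel' hdm).symm fun j i => Ξ i j).symm
  rw [boxSpline, hL]
  refine contDiff_cubeSpline ?_
  rw [Nat.sub_add_cancel hr]
  exact (spansAfterRemoving_columns Ξ).perm (hp.symm.trans (.of_eq hcols))
end

section
/- Let d ≤ m and let Ξ be a real d×m matrix whose first d columns are linearly independent. Let K := ⋃ { Ξμ + span(Z) : Z a subset of the columns of Ξ spanning a (d−1)-dimensional linear subspace of ℝ^d, μ ∈ {−1/2, 1/2}^m }. Then on every connected component of ℝ^d \ K, the centered box spline M_Ξ coincides with a polynomial function of total degree at most m − d. -/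
open MeasureTheory

/-- Every polynomial has a primitive in each coordinate direction, raising the total degree by
at most one. -/
theorem MvPolynomial.exists_pderiv_eq {σ : Type*} (i : σ) (q : MvPolynomial σ ℝ) :
    ∃ Q : MvPolynomial σ ℝ, MvPolynomial.pderiv i Q = q ∧ Q.totalDegree ≤ q.totalDegree + 1 := by
  classical
  refine ⟨∑ s ∈ q.support, MvPolynomial.monomial (s + Finsupp.single i 1)
    (q.coeff s / (s i + 1)), ?_, ?_⟩
  · rw [map_sum]
    conv_rhs => rw [q.as_sum]
    refine Finset.sum_congr rfl fun s _ => ?_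
    have h : ((s i : ℝ) + 1) ≠ 0 := by positivity
    rw [MvPolynomial.pderiv_monomial]
    simp [h]
  · refine MvPolynomial.totalDegree_finsetSum_le fun s hs => ?_
    refine (MvPolynomial.totalDegree_monomial_le _ _).trans ?_
    have := MvPolynomial.le_totalDegree hs
    rw [Finsupp.sum_add_index' (fun _ => rfl) (fun _ _ _ => rfl), Finsupp.sum_single_index rfl]
    exact Nat.add_le_add_right this 1

theorem MvPolynomial.hasDerivAt_eval_add_smul_single {σ : Type*} [DecidableEq σ]
    (i : σ) (Q : MvPolynomial σ ℝ) (y : σ → ℝ) (r : ℝ) :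
    HasDerivAt (fun r : ℝ => MvPolynomial.eval (y + r • Pi.single i (1 : ℝ)) Q)
      (MvPolynomial.eval (y + r • Pi.single i (1 : ℝ)) (MvPolynomial.pderiv i Q)) r := by
  induction Q using MvPolynomial.induction_on with
  | C a => simpa using hasDerivAt_const r a
  | add p q hp hq =>
    simp only [map_add]
    exact hp.add hq
  | mul_X p j hp =>
    have hX : HasDerivAt (fun r : ℝ => (y + r • Pi.single i (1 : ℝ) : σ → ℝ) j)
        ((Pi.single i (1 : ℝ) : σ → ℝ) j) r := by
      simpa using ((hasDerivAt_id r).mul_const ((Pi.single i (1 : ℝ) : σ → ℝ) j)).const_add (y j)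
    simp only [map_mul, MvPolynomial.eval_X, Derivation.leibniz, smul_eq_mul, map_add]
    refine (hp.mul hX).congr_deriv ?_
    rcases eq_or_ne j i with rfl | h
    · simp; ring
    · simp [h, MvPolynomial.pderiv_X_of_ne h]; ring

/-- Composition with an affine map does not increase the total degree of a polynomial. -/
theorem MvPolynomial.exists_eval_affine {σ τ : Type*} [Finite τ]
    (c : σ → ℝ) (L : (τ → ℝ) →ₗ[ℝ] (σ → ℝ)) (p : MvPolynomial σ ℝ) :
    ∃ q : MvPolynomial τ ℝ, q.totalDegree ≤ p.totalDegree ∧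
      ∀ x, MvPolynomial.eval x q = MvPolynomial.eval (c + L x) p := by
  classical
  have := Fintype.ofFinite τ
  let ℓ : σ → MvPolynomial τ ℝ := fun i =>
    MvPolynomial.C (c i) + ∑ j, MvPolynomial.C (L (Pi.single j 1) i) * MvPolynomial.X j
  have hℓ : ∀ i x, MvPolynomial.eval x (ℓ i) = (c + L x) i := by
    intro i x
    have hx : L x = ∑ j, x j • L (Pi.single j 1) := by
      conv_lhs => rw [pi_eq_sum_univ' x]
      simp [map_sum]
    simp [ℓ, hx, mul_comm]
  have hdeg : ∀ i, (ℓ i).totalDegree ≤ 1 := by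
    intro i
    refine (MvPolynomial.totalDegree_add _ _).trans (max_le (by simp) ?_)
    refine MvPolynomial.totalDegree_finsetSum_le fun j _ => ?_
    refine (MvPolynomial.totalDegree_mul _ _).trans ?_
    simp
  refine ⟨MvPolynomial.bind₁ ℓ p, ?_, fun x => ?_⟩
  · conv_lhs => rw [p.as_sum, map_sum]
    refine MvPolynomial.totalDegree_finsetSum_le fun s hs => ?_
    rw [MvPolynomial.bind₁_monomial]
    refine (MvPolynomial.totalDegree_mul _ _).trans ?_
    rw [MvPolynomial.totalDegree_C, zero_add]
    refine (MvPolynomial.totalDegree_finsetProd _ _).trans ?_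
    refine le_trans ?_ (MvPolynomial.le_totalDegree hs)
    refine Finset.sum_le_sum fun j _ => ?_
    refine (MvPolynomial.totalDegree_pow _ _).trans ?_
    simpa using Nat.mul_le_mul_left (s j) (hdeg j)
  · have h : ∀ g : σ → MvPolynomial τ ℝ, MvPolynomial.eval x (MvPolynomial.bind₁ g p) =
        MvPolynomial.eval (fun i => MvPolynomial.eval x (g i)) p := by
      intro g
      induction p using MvPolynomial.induction_on with
      | C a => simp
      | add p q hp hq => simp [hp, hq]
      | mul_X p i hp => simp [hp]
    rw [h]
    simp_rw [hℓ]

/-- Polynomial functions of bounded degree are closed under pointwise limits. -/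
theorem MvPolynomial.exists_eval_eq_of_tendsto {σ : Type*} [Finite σ] {k : ℕ} {s : Set (σ → ℝ)}
    {f : ℕ → (σ → ℝ) → ℝ} {g : (σ → ℝ) → ℝ}
    (hf : ∀ᶠ n in Filter.atTop, ∃ p : MvPolynomial σ ℝ, p.totalDegree ≤ k ∧
      ∀ x ∈ s, f n x = MvPolynomial.eval x p)
    (hg : ∀ x ∈ s, Filter.Tendsto (fun n => f n x) Filter.atTop (nhds (g x))) :
    ∃ p : MvPolynomial σ ℝ, p.totalDegree ≤ k ∧ ∀ x ∈ s, g x = MvPolynomial.eval x p := by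
  let E : MvPolynomial σ ℝ →ₗ[ℝ] (s → ℝ) :=
    LinearMap.pi fun x => (MvPolynomial.aeval (R := ℝ) (x : σ → ℝ)).toLinearMap
  have hE : ∀ p x, E p x = MvPolynomial.eval (x : σ → ℝ) p := fun p x => by
    simp [E]
  let W := (MvPolynomial.restrictTotalDegree σ ℝ k).map E
  have hW : IsClosed (W : Set (s → ℝ)) := W.closed_of_finiteDimensional
  have hlim : Filter.Tendsto (fun n (x : s) => f n x) Filter.atTop (nhds fun x : s => g x) :=
    tendsto_pi_nhds.2 fun x => hg x x.2
  obtain ⟨p, hp, hpg⟩ := hW.mem_of_tendsto hlim (hf.mono fun n ⟨p, hp, h⟩ =>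
    ⟨p, (MvPolynomial.mem_restrictTotalDegree _ _ _).2 hp, by
      ext x
      rw [hE, h x x.2]⟩)
  refine ⟨p, (MvPolynomial.mem_restrictTotalDegree _ _ _).1 hp, fun x hx => ?_⟩
  rw [← hE p ⟨x, hx⟩, hpg]

/-- A function all of whose coordinate increments on a centred cube are integrals of polynomials
of degree less than `k` is a polynomial of degree at most `k` on that cube. -/
theorem MvPolynomial.exists_eval_eq_of_increments {σ : Type*} [Fintype σ] [DecidableEq σ] {k : ℕ}
    {η : ℝ} (hη : 0 < η) {f : (σ → ℝ) → ℝ} {q : σ → MvPolynomial σ ℝ}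
    (hq : ∀ i, q i = 0 ∨ (q i).totalDegree + 1 ≤ k)
    (hf : ∀ i, ∀ y : σ → ℝ, ∀ s : ℝ, (∀ j, |y j| < η) →
      (∀ j, |(y + s • Pi.single i (1 : ℝ) : σ → ℝ) j| < η) →
      f (y + s • Pi.single i (1 : ℝ)) - f y =
        ∫ r in (0 : ℝ)..s, MvPolynomial.eval (y + r • Pi.single i (1 : ℝ)) (q i)) :
    ∃ p : MvPolynomial σ ℝ, p.totalDegree ≤ k ∧
      ∀ x : σ → ℝ, (∀ j, |x j| < η) → f x = MvPolynomial.eval x p := by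
  have hQ : ∀ i, ∃ Q : MvPolynomial σ ℝ, MvPolynomial.pderiv i Q = q i ∧ Q.totalDegree ≤ k := by
    intro i
    rcases hq i with h | h
    · exact ⟨0, by simp [h], by simp⟩
    · obtain ⟨Q, hQ, hd⟩ := MvPolynomial.exists_pderiv_eq i (q i)
      exact ⟨Q, hQ, hd.trans h⟩
  choose Q hQq hQd using hQ
  have hint : ∀ i (y : σ → ℝ) (s : ℝ),
      ∫ r in (0 : ℝ)..s, MvPolynomial.eval (y + r • Pi.single i (1 : ℝ)) (q i) =
        MvPolynomial.eval (y + s • Pi.single i (1 : ℝ)) (Q i) - MvPolynomial.eval y (Q i) := by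
    intro i y s
    rw [intervalIntegral.integral_eq_sub_of_hasDerivAt
      (f := fun r => MvPolynomial.eval (y + r • Pi.single i (1 : ℝ)) (Q i))]
    · simp
    · intro r _
      rw [← hQq i]
      exact MvPolynomial.hasDerivAt_eval_add_smul_single i (Q i) y r
    · refine Continuous.intervalIntegrable ?_ _ _
      exact (MvPolynomial.continuous_eval (q i)).comp (by fun_prop)
  have key : ∀ J : Finset σ, ∃ p : MvPolynomial σ ℝ, p.totalDegree ≤ k ∧
      ∀ x : σ → ℝ, (∀ j, |x j| < η) → f (J.piecewise x 0) = MvPolynomial.eval x p := by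
    intro J
    induction J using Finset.induction_on with
    | empty => exact ⟨MvPolynomial.C (f 0), by simp, fun x _ => by simp⟩
    | insert i J hi ih =>
      obtain ⟨p, hp, hfp⟩ := ih
      let L : Finset σ → (σ → ℝ) →ₗ[ℝ] (σ → ℝ) := fun J =>
        LinearMap.pi fun j => if j ∈ J then LinearMap.proj j else 0
      have hL : ∀ J x, L J x = J.piecewise x 0 := by
        intro J x
        ext j
        by_cases h : j ∈ J <;> simp [L, h]
      obtain ⟨p₁, h₁, e₁⟩ := MvPolynomial.exists_eval_affine 0 (L (insert i J)) (Q i)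
      obtain ⟨p₂, h₂, e₂⟩ := MvPolynomial.exists_eval_affine 0 (L J) (Q i)
      refine ⟨p + (p₁ - p₂), ?_, fun x hx => ?_⟩
      · refine (MvPolynomial.totalDegree_add _ _).trans (max_le hp ?_)
        exact (MvPolynomial.totalDegree_sub _ _).trans
          (max_le (h₁.trans (hQd i)) (h₂.trans (hQd i)))
      · have hin : ∀ J : Finset σ, ∀ j, |J.piecewise x 0 j| < η := by
          intro J j
          by_cases h : j ∈ J
          · simpa [h] using hx j
          · simpa [h] using hη
        have hstep : (insert i J).piecewise x 0 =
            J.piecewise x 0 + x i • (Pi.single i (1 : ℝ) : σ → ℝ) := by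
          ext j
          rcases eq_or_ne j i with rfl | hj
          · simp [hi]
          · by_cases h : j ∈ J <;> simp [hj, h]
        have := hf i (J.piecewise x 0) (x i) (hin J) (by rw [← hstep]; exact hin _)
        rw [hint, ← hstep] at this
        rw [map_add, map_sub, e₁, e₂, hL, hL, zero_add, zero_add, ← hfp x hx, ← this]
        ring
  obtain ⟨p, hp, h⟩ := key Finset.univ
  exact ⟨p, hp, fun x hx => by simpa using h x hx⟩

/-- Version of `MvPolynomial.exists_eval_eq_of_increments` on a parallelepiped spanned by an
arbitrary basis. -/
theorem MvPolynomial.exists_eval_eq_of_basis_increments {σ κ : Type*} [Finite σ] [Fintype κ]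
    (b : Module.Basis κ ℝ (σ → ℝ)) (x₀ : σ → ℝ) {k : ℕ} {η : ℝ} (hη : 0 < η)
    {f : (σ → ℝ) → ℝ} {q : κ → MvPolynomial σ ℝ}
    (hq : ∀ i, q i = 0 ∨ (q i).totalDegree + 1 ≤ k)
    (hf : ∀ i, ∀ y : σ → ℝ, ∀ s : ℝ, (∀ j, |b.equivFun (y - x₀) j| < η) →
      (∀ j, |b.equivFun (y + s • b i - x₀) j| < η) →
      f (y + s • b i) - f y = ∫ r in (0 : ℝ)..s, MvPolynomial.eval (y + r • b i) (q i)) :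
    ∃ p : MvPolynomial σ ℝ, p.totalDegree ≤ k ∧
      ∀ x : σ → ℝ, (∀ j, |b.equivFun (x - x₀) j| < η) → f x = MvPolynomial.eval x p := by
  classical
  let L : (κ → ℝ) →ₗ[ℝ] (σ → ℝ) := b.equivFun.symm.toLinearMap
  have hLs : ∀ i, L (Pi.single i 1) = b i := fun i => by simp [L]
  have hLx : ∀ z, b.equivFun (L z) = z := fun z => b.equivFun.apply_symm_apply z
  have hq' : ∀ i, ∃ Q : MvPolynomial κ ℝ, (Q = 0 ∨ Q.totalDegree + 1 ≤ k) ∧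
      ∀ z, MvPolynomial.eval z Q = MvPolynomial.eval (x₀ + L z) (q i) := by
    intro i
    rcases hq i with h | h
    · exact ⟨0, Or.inl rfl, by simp [h]⟩
    · obtain ⟨Q, hQ, e⟩ := MvPolynomial.exists_eval_affine x₀ L (q i)
      exact ⟨Q, Or.inr (by omega), e⟩
  choose Q hQ hQe using hq'
  have hadd : ∀ (z : κ → ℝ) (s : ℝ) i,
      x₀ + L (z + s • Pi.single i (1 : ℝ)) = x₀ + L z + s • b i := by
    intro z s i
    rw [map_add, map_smul, hLs, add_assoc]
  obtain ⟨p, hp, hpe⟩ := MvPolynomial.exists_eval_eq_of_increments hη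
    (f := fun z => f (x₀ + L z)) hQ (fun i z s h₁ h₂ => by
      simp only [hQe, hadd]
      refine hf i _ s (fun j => ?_) (fun j => ?_)
      · rw [add_sub_cancel_left, hLx]
        exact h₁ j
      · rw [← hadd, add_sub_cancel_left, hLx]
        exact h₂ j)
  obtain ⟨P, hP, hPe⟩ := MvPolynomial.exists_eval_affine (-b.equivFun x₀) b.equivFun.toLinearMap p
  refine ⟨P, hP.trans hp, fun x hx => ?_⟩
  have h : -b.equivFun x₀ + b.equivFun.toLinearMap x = b.equivFun (x - x₀) := by
    rw [map_sub, neg_add_eq_sub]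
    rfl
  have := hpe (b.equivFun (x - x₀)) hx
  have hx' : L (b.equivFun (x - x₀)) = x - x₀ := b.equivFun.symm_apply_apply _
  rw [hPe, h, ← this, hx', add_sub_cancel]

section DirectionalAverage

variable {E : Type*} [NormedAddCommGroup E] [NormedSpace ℝ E]

/-- The average of the translates of a continuous function over a centred segment. -/
noncomputable def dirAverage (v : E) (φ : C(E, ℝ)) : C(E, ℝ) where
  toFun x := ∫ t in (-(1:ℝ)/2)..(1/2), φ (x - t • v)
  continuous_toFun :=
    intervalIntegral.continuous_parametric_intervalIntegral_of_continuous' (by fun_prop) _ _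

theorem dirAverage_apply (v : E) (φ : C(E, ℝ)) (x : E) :
    dirAverage v φ x = ∫ t in (-(1:ℝ)/2)..(1/2), φ (x - t • v) := rfl

instance dirAverage_leftCommutative :
    LeftCommutative (dirAverage : E → C(E, ℝ) → C(E, ℝ)) where
  left_comm v w φ := by
    ext x
    simp only [dirAverage_apply]
    rw [MeasureTheory.intervalIntegral_intervalIntegral_swap]
    · simp only [sub_right_comm]
    · have : Continuous (Function.uncurry fun t s : ℝ => φ (x - t • v - s • w)) := by
        unfold Function.uncurry
        fun_prop
      exact (this.continuousOn.integrableOn_compact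
        (isCompact_uIcc.prod isCompact_uIcc)).mono_set
          (Set.prod_mono Set.uIoc_subset_uIcc Set.uIoc_subset_uIcc)

/-- The successive directional averages of a continuous function, i.e. its convolution with the
box spline measure of a multiset of directions. -/
noncomputable def boxAverage (l : Multiset E) (φ : C(E, ℝ)) : C(E, ℝ) :=
  l.foldr dirAverage φ

theorem boxAverage_cons (v : E) (l : Multiset E) (φ : C(E, ℝ)) :
    boxAverage (v ::ₘ l) φ = dirAverage v (boxAverage l φ) :=
  Multiset.foldr_cons ..

theorem dirAverage_eq_integral_add (v : E) (φ : C(E, ℝ)) (x : E) :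
    dirAverage v φ x = ∫ t in (-(1:ℝ)/2)..(1/2), φ (x + t • v) := by
  rw [dirAverage_apply]
  have := intervalIntegral.integral_comp_neg (a := -(1:ℝ)/2) (b := 1/2)
    (fun t => φ (x + t • v))
  simp only [neg_smul, ← sub_eq_add_neg] at this
  rw [this]
  norm_num [neg_div]

/-- The increment of a directional average is the integral of a central difference. -/
theorem dirAverage_add_smul_sub (v : E) (φ : C(E, ℝ)) (x : E) (s : ℝ) :
    dirAverage v φ (x + s • v) - dirAverage v φ x =
      ∫ r in (0:ℝ)..s, (φ (x + r • v + (1/2 : ℝ) • v) - φ (x + r • v - (1/2 : ℝ) • v)) := by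
  let g : ℝ → ℝ := fun r => φ (x + r • v)
  have hg : Continuous g := by fun_prop
  have hi : ∀ a b, IntervalIntegrable g volume a b := fun a b => hg.intervalIntegrable a b
  have h₁ : dirAverage v φ (x + s • v) = ∫ t in (-(1:ℝ)/2 + s)..(1/2 + s), g t := by
    rw [dirAverage_eq_integral_add, ← intervalIntegral.integral_comp_add_right]
    refine intervalIntegral.integral_congr fun t _ => ?_
    simp only [g, add_smul, add_assoc, add_comm (s • v)]
  have h₂ : ∫ r in (0:ℝ)..s, φ (x + r • v + (1/2 : ℝ) • v) = ∫ t in (1/2 : ℝ)..(1/2 + s), g t := by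
    have := intervalIntegral.integral_comp_add_right (a := 0) (b := s) g (1/2)
    rw [zero_add, add_comm s] at this
    rw [← this]
    simp only [g, add_smul, add_assoc]
  have h₃ : ∫ r in (0:ℝ)..s, φ (x + r • v - (1/2 : ℝ) • v) =
      ∫ t in (-(1:ℝ)/2)..(-(1:ℝ)/2 + s), g t := by
    have := intervalIntegral.integral_comp_add_right (a := 0) (b := s) g (-(1:ℝ)/2)
    rw [zero_add, add_comm s] at this
    rw [← this]
    refine intervalIntegral.integral_congr fun t _ => ?_
    simp only [g, add_smul, neg_div, neg_smul, sub_eq_add_neg, add_assoc]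
  rw [intervalIntegral.integral_sub (Continuous.intervalIntegrable (by fun_prop) _ _)
    (Continuous.intervalIntegrable (by fun_prop) _ _), h₁, h₂, h₃, dirAverage_eq_integral_add]
  have e₁ := intervalIntegral.integral_add_adjacent_intervals (hi (-(1:ℝ)/2) (1/2)) (hi (1/2) (1/2 + s))
  have e₂ := intervalIntegral.integral_add_adjacent_intervals (hi (-(1:ℝ)/2) (-(1:ℝ)/2 + s))
    (hi (-(1:ℝ)/2 + s) (1/2 + s))
  change _ - ∫ t in (-(1:ℝ)/2)..(1/2), g t = _
  linarith

theorem abs_dirAverage_le {φ : C(E, ℝ)} {C : ℝ} (h : ∀ x, |φ x| ≤ C) (v x : E) :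
    |dirAverage v φ x| ≤ C := by
  rw [dirAverage_apply, ← Real.norm_eq_abs]
  refine (intervalIntegral.norm_integral_le_of_norm_le_const (C := C) fun t _ => h _).trans ?_
  norm_num

theorem boxAverage_eq_zero {l : Multiset E} {φ : C(E, ℝ)} {x : E}
    (h : ∀ w ∈ Submodule.span ℝ {v | v ∈ l}, φ (x - w) = 0) : boxAverage l φ x = 0 := by
  induction l using Multiset.induction_on generalizing x with
  | empty => simpa [boxAverage] using h 0 (Submodule.zero_mem _)
  | cons v l ih =>
    rw [boxAverage_cons, dirAverage_apply]
    refine (intervalIntegral.integral_congr (g := fun _ => 0) fun t _ => ih fun w hw => ?_).trans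
      (by simp)
    rw [sub_sub]
    refine h _ (Submodule.add_mem _ (Submodule.smul_mem _ _ (Submodule.subset_span (by simp))) ?_)
    exact Submodule.span_mono (fun u hu => Multiset.mem_cons_of_mem hu) hw

/-- The knot set of a multiset of directions: the translates, by the vertices of the support of the
box spline, of the hyperplanes spanned by directions. -/
def boxKnots (l : Multiset E) : Set E :=
  {x | ∃ Z : Set E, Z ⊆ {v | v ∈ l} ∧
    Module.finrank ℝ ↥(Submodule.span ℝ Z) = Module.finrank ℝ E - 1 ∧
    ∃ a ≤ l, x + (1/2 : ℝ) • l.sum - a.sum ∈ Submodule.span ℝ Z}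

theorem boxKnots_cons_of_add_half {v x : E} {l : Multiset E}
    (h : x + (1/2 : ℝ) • v ∈ boxKnots l) : x ∈ boxKnots (v ::ₘ l) := by
  obtain ⟨Z, hZ, hd, a, ha, hx⟩ := h
  refine ⟨Z, fun u hu => Multiset.mem_cons_of_mem (hZ hu), hd, a,
    ha.trans (Multiset.le_cons_self _ _), ?_⟩
  convert hx using 1
  rw [Multiset.sum_cons, smul_add]
  abel

theorem boxKnots_cons_of_sub_half {v x : E} {l : Multiset E}
    (h : x - (1/2 : ℝ) • v ∈ boxKnots l) : x ∈ boxKnots (v ::ₘ l) := by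
  obtain ⟨Z, hZ, hd, a, ha, hx⟩ := h
  refine ⟨Z, fun u hu => Multiset.mem_cons_of_mem (hZ hu), hd, v ::ₘ a,
    Multiset.cons_le_cons v ha, ?_⟩
  convert hx using 1
  rw [Multiset.sum_cons, Multiset.sum_cons]
  module

theorem countable_setOf_sub_smul_mem_boxKnots {v x : E} {l : Multiset E}
    (h : x ∉ boxKnots (v ::ₘ l)) : {t : ℝ | x - t • v ∈ boxKnots l}.Countable := by
  classical
  have hsub : {t : ℝ | x - t • v ∈ boxKnots l} ⊆
      ⋃ Z ∈ {Z : Set E | Z ⊆ {v | v ∈ l}}, ⋃ a ∈ {a | a ≤ l},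
        {t : ℝ | x - t • v ∈ boxKnots l ∧
          Module.finrank ℝ ↥(Submodule.span ℝ Z) = Module.finrank ℝ E - 1 ∧
          x - t • v + (1/2 : ℝ) • l.sum - a.sum ∈ Submodule.span ℝ Z} := by
    intro t ht
    obtain ⟨Z, hZ, hd, a, ha, hx⟩ := id ht
    simp only [Set.mem_iUnion]
    exact ⟨Z, hZ, a, ha, ht, hd, hx⟩
  refine Set.Countable.mono hsub ?_
  have hl : {v | v ∈ l}.Finite := l.toFinset.finite_toSet.subset fun u hu => by simpa using hu
  have hle : {a | a ≤ l}.Finite :=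
    l.powerset.toFinset.finite_toSet.subset fun u hu => by simpa using hu
  refine hl.finite_subsets.countable.biUnion fun Z hZ => ?_
  refine hle.countable.biUnion fun a ha => ?_
  refine Set.Subsingleton.countable fun t ht s hs => ?_
  by_contra hts
  have hv : v ∈ Submodule.span ℝ Z := by
    have := Submodule.smul_mem _ (s - t)⁻¹ (Submodule.sub_mem _ ht.2.2 hs.2.2)
    have e : x - t • v + (1/2 : ℝ) • l.sum - a.sum - (x - s • v + (1/2 : ℝ) • l.sum - a.sum)
        = (s - t) • v := by module
    rwa [e, smul_smul, inv_mul_cancel₀ (sub_ne_zero.2 (Ne.symm hts)), one_smul] at this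
  refine h (boxKnots_cons_of_add_half ⟨Z, hZ, ht.2.1, a, ha, ?_⟩)
  have := Submodule.add_mem _ ht.2.2 (Submodule.smul_mem _ (t + 1/2) hv)
  convert this using 1
  module

theorem isClosed_boxKnots [FiniteDimensional ℝ E] (l : Multiset E) : IsClosed (boxKnots l) := by
  classical
  have hl : {v | v ∈ l}.Finite := l.toFinset.finite_toSet.subset fun u hu => by simpa using hu
  have hle : {a | a ≤ l}.Finite :=
    l.powerset.toFinset.finite_toSet.subset fun u hu => by simpa using hu
  have : boxKnots l = ⋃ Z ∈ {Z : Set E | Z ⊆ {v | v ∈ l} ∧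
      Module.finrank ℝ ↥(Submodule.span ℝ Z) = Module.finrank ℝ E - 1}, ⋃ a ∈ {a | a ≤ l},
        (fun x => x + (1/2 : ℝ) • l.sum - a.sum) ⁻¹' (Submodule.span ℝ Z : Set E) := by
    ext x
    simp only [boxKnots, Set.mem_iUnion, Set.mem_ofPred_eq, Set.mem_preimage, SetLike.mem_coe,
      exists_prop, and_assoc]
  rw [this]
  refine (hl.finite_subsets.subset fun Z hZ => hZ.1).isClosed_biUnion fun Z _ => ?_
  refine hle.isClosed_biUnion fun a _ => ?_
  exact (Submodule.closed_of_finiteDimensional _).preimage (by fun_prop)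

end DirectionalAverage

theorem finrank_span_eq_of_span_insert_eq_top {E : Type*} [AddCommGroup E] [Module ℝ E]
    [FiniteDimensional ℝ E] {v : E} {s : Set E} (h : Submodule.span ℝ (insert v s) = ⊤)
    (hs : Submodule.span ℝ s ≠ ⊤) :
    Module.finrank ℝ ↥(Submodule.span ℝ s) = Module.finrank ℝ E - 1 := by
  have h₁ := Submodule.finrank_lt hs
  have h₂ := Submodule.finrank_add_le_finrank_add_finrank (Submodule.span ℝ {v})
    (Submodule.span ℝ s)
  rw [← Submodule.span_insert, h, finrank_top] at h₂
  have h₃ := finrank_span_le_card (R := ℝ) ({v} : Set E)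
  simp only [Set.toFinset_singleton, Finset.card_singleton] at h₃
  omega

/-- Away from the knots, all successive averages of functions with sufficiently small support are
polynomials of degree at most `card l - d` on a common neighbourhood. -/
theorem boxAverage_eq_eval_of_notMem_boxKnots {d : ℕ} (l : Multiset (Fin d → ℝ))
    (hl : Submodule.span ℝ {v | v ∈ l} = ⊤) {x₀ : Fin d → ℝ} (hx : x₀ ∉ boxKnots l) :
    ∃ U ∈ nhds x₀, ∃ δ > 0, ∀ φ : C(Fin d → ℝ, ℝ), (∀ x, δ ≤ ‖x‖ → φ x = 0) →
      ∃ p : MvPolynomial (Fin d) ℝ, p.totalDegree ≤ Multiset.card l - d ∧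
        ∀ y ∈ U, boxAverage l φ y = MvPolynomial.eval y p := by
  classical
  induction hn : Multiset.card l using Nat.strong_induction_on generalizing l x₀ with
  | _ n ih =>
  subst hn
  have hside : ∀ v l', l = v ::ₘ l' → ∀ x₁ ∉ boxKnots l',
      ∃ U ∈ nhds x₁, ∃ δ > 0, ∀ φ : C(Fin d → ℝ, ℝ), (∀ x, δ ≤ ‖x‖ → φ x = 0) →
        ∃ p : MvPolynomial (Fin d) ℝ, (p = 0 ∨ p.totalDegree + 1 ≤ Multiset.card l - d) ∧
          ∀ y ∈ U, boxAverage l' φ y = MvPolynomial.eval y p := by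
    rintro v l' rfl x₁ hx₁
    by_cases hs : Submodule.span ℝ {v | v ∈ l'} = ⊤
    · obtain ⟨U, hU, δ, hδ, h⟩ := ih (Multiset.card l') (by simp) l' hs hx₁ rfl
      refine ⟨U, hU, δ, hδ, fun φ hφ => ?_⟩
      obtain ⟨p, hp, e⟩ := h φ hφ
      have hc : d ≤ Multiset.card l' := by
        have h₁ := finrank_span_finset_le_card (R := ℝ) l'.toFinset
        have h₂ : ((l'.toFinset : Finset (Fin d → ℝ)) : Set (Fin d → ℝ)) = {v | v ∈ l'} := by
          ext u
          simp
        rw [Set.finrank, h₂, hs, finrank_top, Module.finrank_fin_fun] at h₁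
        exact h₁.trans (Multiset.toFinset_card_le l')
      exact ⟨p, Or.inr (by rw [Multiset.card_cons]; omega), e⟩
    · have hd := finrank_span_eq_of_span_insert_eq_top (v := v) (s := {v | v ∈ l'})
        (by rw [← hl]; congr 1; ext u; simp) hs
      have hx₂ : x₁ ∉ Submodule.span ℝ {v | v ∈ l'} := by
        refine fun h => hx₁ ⟨_, subset_rfl, hd, 0, Multiset.zero_le _, ?_⟩
        rw [Multiset.sum_zero, sub_zero]
        exact Submodule.add_mem _ h (Submodule.smul_mem _ _
          (multiset_sum_mem _ fun u hu => Submodule.subset_span hu))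
      have hc : IsClosed (Submodule.span ℝ {v | v ∈ l'} : Set (Fin d → ℝ)) :=
        Submodule.closed_of_finiteDimensional _
      obtain ⟨ε, hε, hball⟩ := Metric.isOpen_iff.1 hc.isOpen_compl x₁ hx₂
      refine ⟨Metric.ball x₁ (ε / 2), Metric.ball_mem_nhds _ (by positivity), ε / 2,
        by positivity, fun φ hφ => ⟨0, Or.inl rfl, fun y hy => ?_⟩⟩
      rw [map_zero]
      refine boxAverage_eq_zero fun w hw => hφ _ ?_
      by_contra! hlt
      refine hball (?_ : w ∈ Metric.ball x₁ ε) hw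
      rw [Metric.mem_ball] at hy ⊢
      rw [← dist_eq_norm, dist_comm] at hlt
      linarith [dist_triangle w y x₁]
  obtain ⟨t, htl, hts, hti⟩ := exists_linearIndependent ℝ {v | v ∈ l}
  have hfin : t.Finite := (l.toFinset.finite_toSet.subset fun u hu => by simpa using hu).subset htl
  have := hfin.fintype
  let b : Module.Basis t ℝ (Fin d → ℝ) := Module.Basis.mk hti (by simp [hts, hl])
  have hb : ∀ i, b i = (i : Fin d → ℝ) := fun i => by simp [b]
  have hsplit : ∀ i : t, ∃ l', l = b i ::ₘ l' := fun i => by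
    rw [hb]
    exact Multiset.exists_cons_of_mem (htl i.2)
  choose l' hl' using hsplit
  have hxp : ∀ i, x₀ + (1/2 : ℝ) • b i ∉ boxKnots (l' i) := fun i h =>
    hx (by rw [hl' i]; exact boxKnots_cons_of_add_half h)
  have hxm : ∀ i, x₀ - (1/2 : ℝ) • b i ∉ boxKnots (l' i) := fun i h =>
    hx (by rw [hl' i]; exact boxKnots_cons_of_sub_half h)
  choose U₁ hU₁ δ₁ hδ₁ h₁ using fun i => hside _ _ (hl' i) _ (hxp i)
  choose U₂ hU₂ δ₂ hδ₂ h₂ using fun i => hside _ _ (hl' i) _ (hxm i)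
  obtain ⟨δ, hδ, hδ₁', hδ₂'⟩ : ∃ δ > 0, (∀ i, δ ≤ δ₁ i) ∧ ∀ i, δ ≤ δ₂ i := by
    have e₀ : ∀ᶠ δ : ℝ in nhdsWithin 0 (Set.Ioi 0), 0 < δ := eventually_mem_nhdsWithin
    have e₁ : ∀ᶠ δ : ℝ in nhdsWithin 0 (Set.Ioi 0), ∀ i, δ ≤ δ₁ i := Filter.eventually_all.2
      fun i => nhdsWithin_le_nhds (eventually_le_nhds (hδ₁ i))
    have e₂ : ∀ᶠ δ : ℝ in nhdsWithin 0 (Set.Ioi 0), ∀ i, δ ≤ δ₂ i := Filter.eventually_all.2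
      fun i => nhdsWithin_le_nhds (eventually_le_nhds (hδ₂ i))
    obtain ⟨δ, h⟩ := (e₀.and (e₁.and e₂)).exists
    exact ⟨δ, h⟩
  have hW : ∀ᶠ z : t → ℝ in nhds 0, ∀ i, x₀ + b.equivFun.symm z + (1/2 : ℝ) • b i ∈ U₁ i ∧
      x₀ + b.equivFun.symm z - (1/2 : ℝ) • b i ∈ U₂ i := by
    have hc : Continuous fun z : t → ℝ => b.equivFun.symm z :=
      b.equivFun.symm.toLinearMap.continuous_of_finiteDimensional
    refine Filter.eventually_all.2 fun i => ?_
    have c₁ : Filter.Tendsto (fun z : t → ℝ => x₀ + b.equivFun.symm z + (1/2 : ℝ) • b i) (nhds 0)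
        (nhds (x₀ + (1/2 : ℝ) • b i)) :=
      Continuous.tendsto' (by fun_prop) _ _ (by simp)
    have c₂ : Filter.Tendsto (fun z : t → ℝ => x₀ + b.equivFun.symm z - (1/2 : ℝ) • b i) (nhds 0)
        (nhds (x₀ - (1/2 : ℝ) • b i)) :=
      Continuous.tendsto' (by fun_prop) _ _ (by simp)
    exact (c₁.eventually_mem (hU₁ i)).and (c₂.eventually_mem (hU₂ i))
  obtain ⟨η, hη, hηW⟩ := Metric.eventually_nhds_iff.1 hW
  have hbox : ∀ x, (∀ j, |b.equivFun (x - x₀) j| < η) → ∀ i,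
      x + (1/2 : ℝ) • b i ∈ U₁ i ∧ x - (1/2 : ℝ) • b i ∈ U₂ i := by
    intro x h
    have := @hηW (b.equivFun (x - x₀)) (by
      rw [dist_zero_right, pi_norm_lt_iff hη]
      exact h)
    rwa [LinearEquiv.symm_apply_apply, add_sub_cancel] at this
  have hopen : {x | ∀ j, |b.equivFun (x - x₀) j| < η} ∈ nhds x₀ := by
    have hc : Continuous fun x : Fin d → ℝ => b.equivFun (x - x₀) :=
      b.equivFun.toLinearMap.continuous_of_finiteDimensional.comp (by fun_prop)
    have : Filter.Tendsto (fun x : Fin d → ℝ => b.equivFun (x - x₀)) (nhds x₀) (nhds 0) :=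
      hc.tendsto' _ _ (by simp)
    filter_upwards [this (Metric.ball_mem_nhds 0 hη)] with x hx
    rwa [Set.mem_preimage, mem_ball_zero_iff, pi_norm_lt_iff hη] at hx
  refine ⟨_, hopen, δ, hδ, fun φ hφ => ?_⟩
  choose p₁ hp₁ e₁ using fun i => h₁ i φ fun x hx => hφ x ((hδ₁' i).trans hx)
  choose p₂ hp₂ e₂ using fun i => h₂ i φ fun x hx => hφ x ((hδ₂' i).trans hx)
  have hq : ∀ i, ∃ q : MvPolynomial (Fin d) ℝ,
      (q = 0 ∨ q.totalDegree + 1 ≤ Multiset.card l - d) ∧ ∀ y, MvPolynomial.eval y q =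
        MvPolynomial.eval (y + (1/2 : ℝ) • b i) (p₁ i) -
          MvPolynomial.eval (y - (1/2 : ℝ) • b i) (p₂ i) := by
    intro i
    obtain ⟨Q₁, d₁, E₁⟩ := MvPolynomial.exists_eval_affine ((1/2 : ℝ) • b i) LinearMap.id (p₁ i)
    obtain ⟨Q₂, d₂, E₂⟩ := MvPolynomial.exists_eval_affine (-((1/2 : ℝ) • b i)) LinearMap.id (p₂ i)
    simp only [LinearMap.id_apply, add_comm _ (_ : Fin d → ℝ)] at E₁ E₂
    have hsub := MvPolynomial.totalDegree_sub Q₁ Q₂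
    refine ⟨Q₁ - Q₂, ?_, fun y => ?_⟩
    · rcases Nat.eq_zero_or_pos (Multiset.card l - d) with h0 | hpos
      · have z₁ : p₁ i = 0 := (hp₁ i).resolve_right (by omega)
        have z₂ : p₂ i = 0 := (hp₂ i).resolve_right (by omega)
        left
        refine MvPolynomial.funext fun y => ?_
        rw [map_sub, E₁, E₂, z₁, z₂]
        simp
      · right
        have z₁ : (p₁ i).totalDegree + 1 ≤ Multiset.card l - d := by
          rcases hp₁ i with h | h
          · simp only [h, MvPolynomial.totalDegree_zero]; omega
          · exact h
        have z₂ : (p₂ i).totalDegree + 1 ≤ Multiset.card l - d := by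
          rcases hp₂ i with h | h
          · simp only [h, MvPolynomial.totalDegree_zero]; omega
          · exact h
        have := max_le (a := Q₁.totalDegree) (b := Q₂.totalDegree)
          (c := Multiset.card l - d - 1) (by omega) (by omega)
        omega
    · rw [map_sub, E₁, E₂, ← sub_eq_add_neg]
  choose q hqd hqe using hq
  refine MvPolynomial.exists_eval_eq_of_basis_increments b x₀ hη hqd fun i y s hy hys => ?_
  have hl'i : boxAverage l φ = dirAverage (b i) (boxAverage (l' i) φ) := by
    rw [← boxAverage_cons, ← hl' i]
  rw [hl'i, dirAverage_add_smul_sub]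
  refine intervalIntegral.integral_congr fun r hr => ?_
  have hyr : ∀ j, |b.equivFun (y + r • b i - x₀) j| < η := by
    have hexp : ∀ (r : ℝ) (j : t), b.equivFun (y + r • b i - x₀) j =
        b.equivFun (y - x₀) j + r * if i = j then 1 else 0 := by
      intro r j
      rw [add_sub_right_comm, map_add, map_smul]
      simp [Finsupp.single_apply]
    intro j
    have hj := hy j
    have hj' := hys j
    rw [hexp] at hj' ⊢
    split_ifs at hj' ⊢
    · rw [abs_lt] at hj hj' ⊢
      rcases Set.mem_uIcc.1 hr with h | h <;> constructor <;> linarith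
    · simpa using hj
  simp only [hqe]
  rw [e₁ i _ (hbox _ hyr i).1, e₂ i _ (hbox _ hyr i).2]

theorem exists_bump_of_pos {ε : ℝ} (hε : 0 < ε) :
    ∃ h : C(ℝ, ℝ), (∀ x, 0 ≤ h x) ∧ (∀ x, ε ≤ |x| → h x = 0) ∧ Integrable h ∧ ∫ x, h x = 1 := by
  let f : ContDiffBump (0 : ℝ) := ⟨ε / 2, ε, by positivity, by linarith⟩
  refine ⟨⟨f.normed volume, f.continuous_normed⟩, fun x => f.nonneg_normed x, fun x hx => ?_,
    f.integrable_normed, f.integral_normed⟩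
  have : x ∉ Function.support (f.normed volume) := by
    rw [f.support_normed_eq]
    simpa [f] using hx
  simpa using this

theorem dirAverage_one_apply (h : C(ℝ, ℝ)) (s : ℝ) :
    dirAverage 1 h s = ∫ t in Set.Ioc (s - 1/2) (s + 1/2), h t := by
  rw [dirAverage_apply, ← intervalIntegral.integral_of_le (by linarith)]
  have := intervalIntegral.integral_comp_sub_left (a := -(1:ℝ)/2) (b := 1/2) h s
  simp only [smul_eq_mul, mul_one]
  rw [this]
  congr 1
  ring

theorem dirAverage_one_mem_Icc {h : C(ℝ, ℝ)} (h₀ : ∀ x, 0 ≤ h x) (hi : Integrable h)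
    (h₁ : ∫ x, h x = 1) (s : ℝ) : dirAverage 1 h s ∈ Set.Icc 0 1 := by
  rw [dirAverage_one_apply]
  refine ⟨integral_nonneg h₀, ?_⟩
  rw [← h₁]
  exact setIntegral_le_integral hi (Filter.Eventually.of_forall h₀)

theorem dirAverage_one_eq_ite {h : C(ℝ, ℝ)} {ε s : ℝ} (hs : ∀ x, ε ≤ |x| → h x = 0)
    (h₁ : ∫ x, h x = 1) (hε : ε < |s - 1/2|) (hε' : ε < |s + 1/2|) :
    dirAverage 1 h s = if s ∈ Set.Ico (-(1:ℝ)/2) (1/2) then 1 else 0 := by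
  rw [dirAverage_one_apply]
  split_ifs with hmem
  · rw [← h₁]
    refine setIntegral_eq_integral_of_forall_compl_eq_zero fun x hx => hs x ?_
    rw [Set.mem_Ico] at hmem
    rw [abs_of_nonpos (by linarith)] at hε
    rw [abs_of_nonneg (by linarith)] at hε'
    by_contra! hlt
    rw [abs_lt] at hlt
    exact hx ⟨by linarith, by linarith⟩
  · refine setIntegral_eq_zero_of_forall_eq_zero fun x hx => hs x ?_
    by_contra! hlt
    rw [abs_lt] at hlt
    obtain ⟨hx₁, hx₂⟩ := hx
    rw [Set.mem_Ico, not_and_or, not_le, not_lt] at hmem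
    rcases hmem with hm | hm
    · rw [abs_of_nonpos (by linarith)] at hε'
      linarith
    · rw [abs_of_nonneg (by linarith)] at hε
      linarith

section BoxBasis

variable {E : Type*} [NormedAddCommGroup E] [NormedSpace ℝ E] {ι : Type*} [Fintype ι]

theorem mem_boxKnots_of_equivFun_eq_half (b : Module.Basis ι ℝ E) {x : E} {j : ι}
    (h : b.equivFun x j = 1/2 ∨ b.equivFun x j = -(1/2)) :
    x ∈ boxKnots (Finset.univ.val.map b) := by
  classical
  have hspan : ∀ z : E, b.equivFun z j = 0 → z ∈ Submodule.span ℝ (b '' {i | i ≠ j}) := by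
    intro z hz
    rw [← b.sum_equivFun z]
    refine Submodule.sum_mem _ fun i _ => ?_
    rcases eq_or_ne i j with rfl | hi
    · simp [hz]
    · exact Submodule.smul_mem _ _ (Submodule.subset_span ⟨i, hi, rfl⟩)
  have hsum : b.equivFun ((Finset.univ.val.map b).sum) j = 1 := by
    change b.equivFun (∑ i, b i) j = 1
    simp [Finsupp.single_apply]
  refine ⟨b '' {i | i ≠ j}, ?_, ?_, ?_⟩
  · rintro _ ⟨i, _, rfl⟩
    simp
  · have hli : LinearIndependent ℝ fun i : {i // i ≠ j} => b i :=
      b.linearIndependent.comp _ Subtype.val_injective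
    have hr : b '' {i | i ≠ j} = Set.range fun i : {i // i ≠ j} => b i := by
      ext z
      simp
    rw [hr, finrank_span_eq_card hli, Module.finrank_eq_card_basis b]
    simp
  · rcases h with h | h
    · refine ⟨{b j}, ?_, hspan _ ?_⟩
      · simp
      · rw [map_sub, map_add, map_smul, Pi.sub_apply, Pi.add_apply, Pi.smul_apply, hsum, h]
        simp
        norm_num
    · refine ⟨0, Multiset.zero_le _, hspan _ ?_⟩
      rw [map_sub, map_add, map_smul, Pi.sub_apply, Pi.add_apply, Pi.smul_apply, hsum, h]
      simp

variable [FiniteDimensional ℝ E]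

/-- A product function in the coordinates of a basis. -/
noncomputable def coordProd (b : Module.Basis ι ℝ E) (c : ℝ) (h : ι → C(ℝ, ℝ)) : C(E, ℝ) where
  toFun x := c * ∏ j, h j (b.equivFun x j)
  continuous_toFun := by
    have : Continuous b.equivFun := b.equivFun.toLinearMap.continuous_of_finiteDimensional
    fun_prop

theorem dirAverage_coordProd [DecidableEq ι] (b : Module.Basis ι ℝ E) (c : ℝ) (h : ι → C(ℝ, ℝ))
    (i : ι) : dirAverage (b i) (coordProd b c h) =
      coordProd b c (Function.update h i (dirAverage 1 (h i))) := by
  ext x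
  rw [dirAverage_apply]
  have hsplit : ∀ t : ℝ, coordProd b c h (x - t • b i) =
      (c * ∏ j ∈ Finset.univ.erase i, h j (b.equivFun x j)) * h i (b.equivFun x i - t • 1) := by
    intro t
    change c * _ = _
    rw [← Finset.mul_prod_erase _ _ (Finset.mem_univ i), mul_assoc, mul_comm (Finset.prod _ _)]
    congr 2
    · simp
    · refine Finset.prod_congr rfl fun j hj => ?_
      simp [(Finset.ne_of_mem_erase hj).symm]
  simp only [hsplit]
  rw [intervalIntegral.integral_const_mul, ← dirAverage_apply]
  change _ = c * _
  rw [← Finset.mul_prod_erase _ _ (Finset.mem_univ i), mul_assoc, mul_comm (Finset.prod _ _)]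
  congr 2
  · simp
  · refine Finset.prod_congr rfl fun j hj => ?_
    rw [Function.update_of_ne (Finset.ne_of_mem_erase hj)]

theorem boxAverage_coordProd (b : Module.Basis ι ℝ E) (c : ℝ) (h : C(ℝ, ℝ)) :
    boxAverage (Finset.univ.val.map b) (coordProd b c fun _ => h) =
      coordProd b c fun _ => dirAverage 1 h := by
  classical
  have key : ∀ J : Finset ι, boxAverage (J.val.map b) (coordProd b c fun _ => h) =
      coordProd b c (J.piecewise (fun _ => dirAverage 1 h) fun _ => h) := by
    intro J
    induction J using Finset.induction_on with
    | empty => simp [boxAverage]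
    | insert i J hi ih =>
      rw [Finset.insert_val_of_notMem hi, Multiset.map_cons, boxAverage_cons, ih,
        dirAverage_coordProd, Finset.piecewise_insert, Finset.piecewise_eq_of_notMem _ _ _ hi]
  simpa using key Finset.univ

/-- Approximate identities whose averages along a basis converge to the normalized indicator of a
half-open parallelepiped away from the knots. -/
theorem exists_tendsto_boxAverage_basis (b : Module.Basis ι ℝ E) {c : ℝ} (hc : 0 ≤ c) :
    ∃ φ : ℕ → C(E, ℝ), (∀ δ > 0, ∀ᶠ n in Filter.atTop, ∀ x, δ ≤ ‖x‖ → φ n x = 0) ∧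
      (∀ n x, |boxAverage (Finset.univ.val.map b) (φ n) x| ≤ c) ∧
      ∀ x ∉ boxKnots (Finset.univ.val.map b), ∀ y : ℝ,
        ((∀ j, b.equivFun x j ∈ Set.Ico (-(1:ℝ)/2) (1/2)) → y = c) →
        ((¬ ∀ j, b.equivFun x j ∈ Set.Ico (-(1:ℝ)/2) (1/2)) → y = 0) →
        Filter.Tendsto (fun n => boxAverage (Finset.univ.val.map b) (φ n) x) Filter.atTop
          (nhds y) := by
  classical
  choose h h₀ hs hi h₁ using fun n : ℕ => exists_bump_of_pos (ε := 1 / ((n : ℝ) + 1)) (by positivity)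
  have hlim : Filter.Tendsto (fun n : ℕ => 1 / ((n : ℝ) + 1)) Filter.atTop (nhds 0) :=
    tendsto_one_div_add_atTop_nhds_zero_nat
  refine ⟨fun n => coordProd b c fun _ => h n, fun δ hδ => ?_, fun n x => ?_, fun x hx y hy hy' => ?_⟩
  · have hc : Continuous fun z : ι → ℝ => b.equivFun.symm z :=
      b.equivFun.symm.toLinearMap.continuous_of_finiteDimensional
    have : Filter.Tendsto (fun z : ι → ℝ => b.equivFun.symm z) (nhds 0) (nhds 0) :=
      hc.tendsto' _ _ (by simp)
    obtain ⟨η, hη, hball⟩ := Metric.eventually_nhds_iff.1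
      (this.eventually_mem (Metric.ball_mem_nhds 0 hδ))
    filter_upwards [hlim.eventually_lt_const hη] with n hn x hx
    have hex : ∃ j, 1 / ((n : ℝ) + 1) ≤ |b.equivFun x j| := by
      by_contra! hlt
      have := @hball (b.equivFun x) (by
        rw [dist_zero_right, pi_norm_lt_iff hη]
        exact fun j => (hlt j).trans hn)
      rw [LinearEquiv.symm_apply_apply, mem_ball_zero_iff] at this
      linarith
    obtain ⟨j, hj⟩ := hex
    change c * _ = 0
    rw [Finset.prod_eq_zero (Finset.mem_univ j) (hs n _ hj), mul_zero]
  · rw [boxAverage_coordProd]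
    change |c * _| ≤ c
    have hm := fun j => dirAverage_one_mem_Icc (h₀ n) (hi n) (h₁ n) (b.equivFun x j)
    rw [abs_of_nonneg (mul_nonneg hc (Finset.prod_nonneg fun j _ => (hm j).1))]
    exact mul_le_of_le_one_right hc (Finset.prod_le_one (fun j _ => (hm j).1) fun j _ => (hm j).2)
  · have hne : ∀ j, 0 < |b.equivFun x j - 1/2| ∧ 0 < |b.equivFun x j + 1/2| := by
      intro j
      constructor <;> rw [abs_pos] <;> intro h
      · exact hx (mem_boxKnots_of_equivFun_eq_half b (Or.inl (sub_eq_zero.1 h)))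
      · exact hx (mem_boxKnots_of_equivFun_eq_half b (Or.inr (eq_neg_of_add_eq_zero_left h)))
    have hev : ∀ᶠ n : ℕ in Filter.atTop, ∀ j, 1 / ((n : ℝ) + 1) < |b.equivFun x j - 1/2| ∧
        1 / ((n : ℝ) + 1) < |b.equivFun x j + 1/2| := Filter.eventually_all.2 fun j =>
      (hlim.eventually_lt_const (hne j).1).and (hlim.eventually_lt_const (hne j).2)
    refine tendsto_nhds_of_eventually_eq (hev.mono fun n hn => ?_)
    rw [boxAverage_coordProd]
    change c * ∏ j, dirAverage 1 (h n) (b.equivFun x j) = y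
    simp only [fun j => dirAverage_one_eq_ite (hs n) (h₁ n) (hn j).1 (hn j).2]
    by_cases hall : ∀ j, b.equivFun x j ∈ Set.Ico (-(1:ℝ)/2) (1/2)
    · rw [hy hall, Finset.prod_congr rfl fun j _ => if_pos (hall j)]
      simp
    · rw [hy' hall]
      push Not at hall
      obtain ⟨j, hj⟩ := hall
      rw [Finset.prod_eq_zero (Finset.mem_univ j) (if_neg hj), mul_zero]

end BoxBasis

section Columns

/-- The multiset of columns of a matrix. -/
def Matrix.columns {d m : ℕ} (Ξ : Matrix (Fin d) (Fin m) ℝ) : Multiset (Fin d → ℝ) :=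
  Finset.univ.val.map Ξ.col

variable {d m : ℕ}

theorem Matrix.setOf_mem_columns (Ξ : Matrix (Fin d) (Fin m) ℝ) :
    {v | v ∈ Ξ.columns} = Set.range Ξ.col := by
  ext v
  simp [Matrix.columns]

theorem Matrix.columns_succ (Ξ : Matrix (Fin d) (Fin (m + 1)) ℝ) :
    Ξ.columns = Ξ.col (Fin.last m) ::ₘ (Ξ.submatrix id Fin.castSucc).columns := by
  rw [Matrix.columns, Fin.univ_castSuccEmb, Finset.cons_val, Multiset.map_cons, Finset.map_val,
    Multiset.map_map]
  rfl

theorem Matrix.columns_cast {k : ℕ} (h : k = m) (Ξ : Matrix (Fin d) (Fin m) ℝ) :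
    (Ξ.submatrix id (Fin.cast h)).columns = Ξ.columns := by
  subst h
  rfl

theorem Matrix.mulVec_ite_half (Ξ : Matrix (Fin d) (Fin m) ℝ) (s : Finset (Fin m)) :
    Ξ.mulVec (fun i => if i ∈ s then 1/2 else -(1:ℝ)/2) =
      (s.val.map Ξ.col).sum - (1/2 : ℝ) • Ξ.columns.sum := by
  change _ = ∑ j ∈ s, Ξ.col j - (1/2 : ℝ) • ∑ j, Ξ.col j
  rw [Matrix.mulVec_eq_sum, ← Finset.sum_ite_mem_eq s, Finset.smul_sum, ← Finset.sum_sub_distrib]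
  refine Finset.sum_congr rfl fun j _ => ?_
  ext i
  by_cases hj : j ∈ s
  · simp [hj]
    ring
  · simp [hj]
    ring

theorem boxKnots_columns (Ξ : Matrix (Fin d) (Fin m) ℝ) :
    boxKnots Ξ.columns = {x : Fin d → ℝ | ∃ (Z : Set (Fin d → ℝ)) (μ : Fin m → ℝ),
      Z ⊆ Set.range (fun j : Fin m => fun i => Ξ i j) ∧
      Module.finrank ℝ ↥(Submodule.span ℝ Z) = d - 1 ∧
      (∀ i, μ i = -(1:ℝ)/2 ∨ μ i = 1/2) ∧
      x - Ξ.mulVec μ ∈ Submodule.span ℝ Z} := by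
  classical
  have hsub : ∀ (x : Fin d → ℝ) (s : Finset (Fin m)),
      x - Ξ.mulVec (fun i => if i ∈ s then 1/2 else -(1:ℝ)/2) =
        x + (1/2 : ℝ) • Ξ.columns.sum - (s.val.map Ξ.col).sum := by
    intro x s
    rw [Matrix.mulVec_ite_half]
    abel
  ext x
  constructor
  · rintro ⟨Z, hZ, hr, a, ha, hx⟩
    rw [Matrix.setOf_mem_columns] at hZ
    rw [Module.finrank_fin_fun] at hr
    have hmem := Multiset.mem_powersetCard.2 ⟨ha, rfl⟩
    rw [Matrix.columns, Multiset.powersetCard_map, Multiset.mem_map] at hmem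
    obtain ⟨b, hb, rfl⟩ := hmem
    have hnd : b.Nodup := Multiset.nodup_of_le (Multiset.mem_powersetCard.1 hb).1 Finset.univ.nodup
    refine ⟨Z, fun i => if i ∈ (⟨b, hnd⟩ : Finset (Fin m)) then 1/2 else -(1:ℝ)/2, hZ, hr,
      fun i => ?_, ?_⟩
    · dsimp only
      split_ifs <;> simp
    · rwa [hsub]
  · rintro ⟨Z, μ, hZ, hr, hμ, hx⟩
    refine ⟨Z, ?_, ?_, (Finset.univ.filter fun i => μ i = 1/2).val.map Ξ.col,
      Multiset.map_le_map (Finset.val_le_iff.2 (Finset.filter_subset _ _)), ?_⟩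
    · rwa [Matrix.setOf_mem_columns]
    · rwa [Module.finrank_fin_fun]
    · rw [← hsub]
      convert hx using 3
      ext i
      rcases hμ i with h | h
      · rw [if_neg, h]
        simp only [Finset.mem_filter, h]
        norm_num
      · simp [h]

end Columns

section BoxSplineLimit

variable {d : ℕ}

/-- Away from the knots, a box spline is the pointwise limit of iterated averages of
continuous functions supported near the origin. -/
theorem exists_tendsto_boxSplineAux (n : ℕ) (Ξ : Matrix (Fin d) (Fin (d + n)) ℝ)
    (hΞ : LinearIndependent ℝ fun j : Fin d => Ξ.col (Fin.castAdd n j)) :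
    ∃ (φ : ℕ → C(Fin d → ℝ, ℝ)) (C : ℝ),
      (∀ δ > 0, ∀ᶠ k in Filter.atTop, ∀ x, δ ≤ ‖x‖ → φ k x = 0) ∧
      (∀ k x, |boxAverage Ξ.columns (φ k) x| ≤ C) ∧
      ∀ x ∉ boxKnots Ξ.columns,
        Filter.Tendsto (fun k => boxAverage Ξ.columns (φ k) x) Filter.atTop
          (nhds (boxSplineAux d n Ξ x)) := by
  induction n with
  | zero =>
    let b : Module.Basis (Fin d) ℝ (Fin d → ℝ) := Module.Basis.mk hΞ
      (hΞ.span_eq_top_of_card_eq_finrank' (by simp)).ge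
    have hb : Finset.univ.val.map b = Ξ.columns := by
      rw [Module.Basis.coe_mk]
      rfl
    have hmem : ∀ x, (∃ t : Fin d → ℝ, (∀ i, t i ∈ Set.Ico (-(1:ℝ)/2) (1/2)) ∧
        x = Matrix.mulVec (Matrix.of fun (i j : Fin d) =>
          Ξ i (Fin.cast (Nat.add_zero d).symm j)) t) ↔
        ∀ j, b.equivFun x j ∈ Set.Ico (-(1:ℝ)/2) (1/2) := by
      intro x
      have hcomb : ∀ t : Fin d → ℝ, Matrix.mulVec (Matrix.of fun (i j : Fin d) =>
          Ξ i (Fin.cast (Nat.add_zero d).symm j)) t = b.equivFun.symm t := by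
        intro t
        rw [Module.Basis.equivFun_symm_apply, Matrix.mulVec_eq_sum]
        simp only [b, Module.Basis.mk_apply]
        refine Finset.sum_congr rfl fun j _ => ?_
        ext i
        exact mul_comm _ _
      simp only [hcomb]
      constructor
      · rintro ⟨t, ht, rfl⟩
        rwa [LinearEquiv.apply_symm_apply]
      · intro h
        exact ⟨b.equivFun x, h, by simp⟩
    obtain ⟨φ, hs, hbd, ht⟩ := exists_tendsto_boxAverage_basis b
      (c := |Matrix.det (Matrix.of fun (i j : Fin d) =>
        Ξ i (Fin.cast (Nat.add_zero d).symm j))|⁻¹) (by positivity)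
    rw [hb] at hbd ht
    refine ⟨φ, _, hs, hbd, fun x hx => ht x hx _ (fun h => ?_) fun h => ?_⟩
    · rw [boxSplineAux]
      refine Set.indicator_of_mem ?_ _
      exact (hmem x).2 h
    · rw [boxSplineAux]
      refine Set.indicator_of_notMem ?_ _
      exact fun h' => h ((hmem x).1 h')
  | succ n ih =>
    obtain ⟨φ, C, hs, hbd, ht⟩ := ih (Ξ.submatrix id Fin.castSucc) hΞ
    have hcol : Ξ.columns = Ξ.col (Fin.last (d + n)) ::ₘ
      (Ξ.submatrix id Fin.castSucc).columns := Matrix.columns_succ Ξ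
    rw [hcol]
    simp only [boxAverage_cons]
    refine ⟨φ, C, hs, fun k x => abs_dirAverage_le (hbd k) _ _, fun x hx => ?_⟩
    simp only [dirAverage_apply]
    refine intervalIntegral.tendsto_integral_filter_of_dominated_convergence (fun _ => C) ?_ ?_
      intervalIntegrable_const ?_
    · refine Filter.Eventually.of_forall fun k => Continuous.aestronglyMeasurable ?_
      fun_prop
    · exact Filter.Eventually.of_forall fun k => Filter.Eventually.of_forall fun t _ => hbd k _
    · filter_upwards [(countable_setOf_sub_smul_mem_boxKnots hx).ae_notMem volume] with t h _
      exact ht _ h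

end BoxSplineLimit

/-- Polynomials which agree near a point are equal. -/
theorem MvPolynomial.eq_of_eventually_eval_eq {d : ℕ} {p q : MvPolynomial (Fin d) ℝ}
    {x : Fin d → ℝ} (h : ∀ᶠ y in nhds x, eval y p = eval y q) : p = q := by
  obtain ⟨ε, hε, hball⟩ := Metric.eventually_nhds_iff_ball.1 h
  refine funext_set (fun i => Metric.ball (x i) ε) (fun i => ?_) fun y hy => hball y ?_
  · rw [Real.ball_eq_Ioo]
    exact Set.Ioo_infinite (by linarith)
  · rwa [ball_pi _ hε]

/-- A function which is locally polynomial of degree at most `k` on an open set is polynomial of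
degree at most `k` on each of its connected components. -/
theorem exists_eval_eq_on_connectedComponentIn {d k : ℕ} {V : Set (Fin d → ℝ)}
    {f : (Fin d → ℝ) → ℝ}
    (h : ∀ x ∈ V, ∃ p : MvPolynomial (Fin d) ℝ, p.totalDegree ≤ k ∧
      ∀ᶠ y in nhds x, f y = MvPolynomial.eval y p) {x : Fin d → ℝ} (hx : x ∈ V) :
    ∃ p : MvPolynomial (Fin d) ℝ, p.totalDegree ≤ k ∧
      ∀ y ∈ connectedComponentIn V x, f y = MvPolynomial.eval y p := by
  classical
  choose! p hp hf using h
  let _ : TopologicalSpace (MvPolynomial (Fin d) ℝ) := ⊥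
  have : DiscreteTopology (MvPolynomial (Fin d) ℝ) := ⟨rfl⟩
  have hsub := connectedComponentIn_subset V x
  have hcont : ContinuousOn p (connectedComponentIn V x) := by
    intro y hy
    refine (continuousWithinAt_const (b := p y)).congr_of_eventuallyEq ?_ rfl
    filter_upwards [nhdsWithin_le_nhds (hf y (hsub hy)).eventually_nhds,
      self_mem_nhdsWithin] with z hz hzV
    exact MvPolynomial.eq_of_eventually_eval_eq (x := z)
      (by filter_upwards [hz, hf z (hsub hzV)] with w h₁ h₂ using h₂.symm.trans h₁)
  refine ⟨p x, hp x hx, fun y hy => ?_⟩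
  rw [isPreconnected_connectedComponentIn.constant hcont (mem_connectedComponentIn hx) hy]
  exact (hf y (hsub hy)).self_of_nhds

/-- away from the knot set `K` (translates, by vertices `Ξμ` of the
support, of the hyperplanes spanned by `d-1`-dimensionally spanning subsets of the
columns), the centered box spline coincides, on each connected component of the
complement of `K`, with a polynomial of total degree at most `m - d`. -/
theorem boxSpline_piecewise_polynomial {d m : ℕ} (hd : 1 ≤ d) (hdm : d ≤ m)
    (Ξ : Matrix (Fin d) (Fin m) ℝ)
    (hΞ : LinearIndependent ℝ fun j : Fin d => fun i => Ξ i (Fin.castLE hdm j))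
    (K : Set (Fin d → ℝ))
    (hK : K = {x : Fin d → ℝ | ∃ (Z : Set (Fin d → ℝ)) (μ : Fin m → ℝ),
      Z ⊆ Set.range (fun j : Fin m => fun i => Ξ i j) ∧
      Module.finrank ℝ ↥(Submodule.span ℝ Z) = d - 1 ∧
      (∀ i, μ i = -(1:ℝ)/2 ∨ μ i = 1/2) ∧
      x - Ξ.mulVec μ ∈ Submodule.span ℝ Z}) :
    ∀ x ∈ Kᶜ, ∃ p : MvPolynomial (Fin d) ℝ, p.totalDegree ≤ m - d ∧
      ∀ y ∈ connectedComponentIn Kᶜ x, boxSpline hdm Ξ y = MvPolynomial.eval y p := by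
  subst hK
  rw [← boxKnots_columns]
  have hcols := Matrix.columns_cast (Nat.add_sub_cancel' hdm) Ξ
  obtain ⟨φ, C, hs, -, ht⟩ := exists_tendsto_boxSplineAux (m - d)
    (Ξ.submatrix id (Fin.cast (Nat.add_sub_cancel' hdm))) hΞ
  rw [hcols] at ht
  have hspan : Submodule.span ℝ {v | v ∈ Ξ.columns} = ⊤ := by
    rw [Matrix.setOf_mem_columns, eq_top_iff,
      ← hΞ.span_eq_top_of_card_eq_finrank' (by simp)]
    refine Submodule.span_mono ?_
    rintro _ ⟨j, rfl⟩
    exact ⟨_, rfl⟩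
  have hcard : Ξ.columns.card = m := by simp [Matrix.columns]
  refine fun x hx => exists_eval_eq_on_connectedComponentIn (fun z hz => ?_) hx
  obtain ⟨U, hU, δ, hδ, hpoly⟩ := boxAverage_eq_eval_of_notMem_boxKnots _ hspan hz
  rw [hcard] at hpoly
  obtain ⟨p, hp, hpeq⟩ := MvPolynomial.exists_eval_eq_of_tendsto
    (s := U ∩ (boxKnots Ξ.columns)ᶜ) (k := m - d)
    (f := fun k => boxAverage Ξ.columns (φ k)) (g := boxSpline hdm Ξ)
    ((hs δ hδ).mono fun k hk => by
      obtain ⟨p, hp, h⟩ := hpoly (φ k) hk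
      exact ⟨p, hp, fun y hy => h y hy.1⟩)
    fun y hy => ht y hy.2
  refine ⟨p, hp, ?_⟩
  filter_upwards [hU, (isClosed_boxKnots Ξ.columns).isOpen_compl.mem_nhds hz] with y h₁ h₂
  exact hpeq y ⟨h₁, h₂⟩
end
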